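/- Let k ≥ 2 be an integer and let G be a minimally (k,k)-edge-connected graph of order n ≥ 4k. Then the spectral radius satisfies ρ(G) ≤ (1/2)·√(4n − 2k − 4 + 2·√(5k² − 8kn + 4n² − 4k + 4)), with equality if and only if G is isomorphic to K^{k−2}_{2,n−k}. -/

import Mathlib

open SimpleGraph

/-- The `l`-edge-connectivity of a graph: the minimum number of edges whose removal
leaves a graph with at least `l` connected components, if the graph has at least `l`
vertices; otherwise the number of vertices. -/
noncomputable def edgeConnL {V : Type*} (l : ℕ) (G : SimpleGraph V) : ℕ :=
  if l ≤ Nat.card V then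
    sInf {c : ℕ | ∃ F : Set (Sym2 V), F ⊆ G.edgeSet ∧ F.ncard = c ∧
      l ≤ Nat.card (G.deleteEdges F).ConnectedComponent}
  else Nat.card V

/-- A graph is minimally `(k,l)`-edge-connected if it is connected, its
`l`-edge-connectivity is at least `k`, and deleting any edge drops the
`l`-edge-connectivity below `k`. -/
def IsMinimallyKLEdgeConnected {V : Type*} (k l : ℕ) (G : SimpleGraph V) : Prop :=
  G.Connected ∧ k ≤ edgeConnL l G ∧
    ∀ e ∈ G.edgeSet, edgeConnL l (G.deleteEdges {e}) < k

/-- The real adjacency matrix of a simple graph. -/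
noncomputable def adjMat {V : Type*} (G : SimpleGraph V) : Matrix V V ℝ :=
  letI := Classical.decRel G.Adj
  G.adjMatrix ℝ

/-- The spectral radius of a graph: the largest (real) eigenvalue of its adjacency matrix. -/
noncomputable def specRad {V : Type*} [Fintype V] [DecidableEq V]
    (G : SimpleGraph V) : ℝ :=
  sSup (spectrum ℝ (adjMat G))

abbrev KbookV (p s : ℕ) : Type := (Unit ⊕ Unit) ⊕ (Fin s ⊕ Fin p)

/-- `K^{p}_{2,s}`: the graph obtained from the disjoint union of the star `K_{1,p}` and the
complete bipartite graph `K_{2,s}` by identifying the centre of the star with one of the two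
vertices of degree `s` of `K_{2,s}`.  Here `Sum.inl (Sum.inl _)` is the identified vertex,
`Sum.inl (Sum.inr _)` is the other vertex of the part of size two, `Fin s` is the part of
size `s` and `Fin p` are the pendant vertices. -/
def Kbook (p s : ℕ) : SimpleGraph (KbookV p s) :=
  SimpleGraph.fromRel (fun a b =>
    match a, b with
    | Sum.inl (Sum.inl _), Sum.inr _ => True
    | Sum.inl (Sum.inr _), Sum.inr (Sum.inl _) => True
    | _, _ => False)

section Spectral

variable {V : Type*} [Fintype V]

/-- The neighbours of `t` as a finset, with classical decidability. -/
noncomputable def nb (G : SimpleGraph V) (t : V) : Finset V :=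
  letI := Classical.decRel G.Adj
  Finset.univ.filter (fun a => G.Adj t a)

@[simp] lemma mem_nb {G : SimpleGraph V} {t a : V} : a ∈ nb G t ↔ G.Adj t a := by
  simp [nb]

lemma adjMat_mulVec (G : SimpleGraph V) (x : V → ℝ) (a : V) :
    (adjMat G).mulVec x a = ∑ b ∈ nb G a, x b := by
  classical
  simp only [Matrix.mulVec, dotProduct, adjMat, nb, SimpleGraph.adjMatrix_apply, ite_mul,
    one_mul, zero_mul]
  rw [Finset.sum_filter]

omit [Fintype V] in
lemma adjMat_isHermitian (G : SimpleGraph V) : (adjMat G).IsHermitian := by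
  classical
  ext a b
  simp [adjMat, SimpleGraph.adjMatrix_apply, G.adj_comm]

variable [DecidableEq V]

lemma bddAbove_spectrum_adjMat (G : SimpleGraph V) : BddAbove (spectrum ℝ (adjMat G)) :=
  (Matrix.finite_real_spectrum (A := adjMat G)).bddAbove

lemma posSemidef_specRad_sub (G : SimpleGraph V) :
    (specRad G • (1 : Matrix V V ℝ) - adjMat G).PosSemidef := by
  rw [Matrix.posSemidef_iff_isHermitian_and_spectrum_nonneg]
  refine ⟨?_, ?_⟩
  · refine Matrix.IsHermitian.sub ?_ (adjMat_isHermitian G)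
    simp [Matrix.IsHermitian]
  · intro a ha
    have h1 : specRad G • (1 : Matrix V V ℝ) = algebraMap ℝ (Matrix V V ℝ) (specRad G) := by
      rw [Algebra.algebraMap_eq_smul_one]
    rw [h1, ← spectrum.singleton_sub_eq] at ha
    obtain ⟨c, hc, d, hd, rfl⟩ := ha
    have : d ≤ specRad G := le_csSup (bddAbove_spectrum_adjMat G) hd
    simp only [Set.mem_singleton_iff] at hc
    subst hc
    simpa using this

lemma dot_specRad_sub (G : SimpleGraph V) (x : V → ℝ) :
    x ⬝ᵥ (specRad G • (1 : Matrix V V ℝ) - adjMat G).mulVec x =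
      specRad G * ∑ a, x a ^ 2 - ∑ a, x a * ∑ b ∈ nb G a, x b := by
  rw [Matrix.sub_mulVec, Matrix.smul_mulVec, Matrix.one_mulVec]
  simp only [dotProduct, Pi.sub_apply, Pi.smul_apply, smul_eq_mul, adjMat_mulVec, mul_sub,
    Finset.sum_sub_distrib]
  congr 1
  rw [Finset.mul_sum]
  exact Finset.sum_congr rfl fun a _ => by ring

lemma quad_le_specRad (G : SimpleGraph V) (x : V → ℝ) :
    ∑ a, x a * ∑ b ∈ nb G a, x b ≤ specRad G * ∑ a, x a ^ 2 := by
  have h := (posSemidef_specRad_sub G).dotProduct_mulVec_nonneg x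
  rw [star_trivial, dot_specRad_sub] at h
  linarith

lemma eigen_of_quad_eq (G : SimpleGraph V) (x : V → ℝ)
    (h : specRad G * ∑ a, x a ^ 2 ≤ ∑ a, x a * ∑ b ∈ nb G a, x b) (a : V) :
    ∑ b ∈ nb G a, x b = specRad G * x a := by
  have h0 : star x ⬝ᵥ (specRad G • (1 : Matrix V V ℝ) - adjMat G).mulVec x = 0 := by
    rw [star_trivial, dot_specRad_sub]
    linarith [quad_le_specRad G x]
  have h1 := congrFun (((posSemidef_specRad_sub G).dotProduct_mulVec_zero_iff x).1 h0) a
  rw [Matrix.sub_mulVec, Matrix.smul_mulVec, Matrix.one_mulVec] at h1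
  simp only [Pi.sub_apply, Pi.smul_apply, smul_eq_mul, adjMat_mulVec, Pi.zero_apply] at h1
  linarith

lemma exists_nonneg_eigenvector [Nonempty V] (G : SimpleGraph V) :
    ∃ x : V → ℝ, (∀ a, 0 ≤ x a) ∧ x ≠ 0 ∧ ∀ a, ∑ b ∈ nb G a, x b = specRad G * x a := by
  have hs : specRad G ∈ spectrum ℝ (adjMat G) := by
    refine Set.Nonempty.csSup_mem ?_ (Matrix.finite_real_spectrum (A := adjMat G))
    rw [(adjMat_isHermitian G).spectrum_real_eq_range_eigenvalues]
    exact Set.range_nonempty _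
  have hdet : (specRad G • (1 : Matrix V V ℝ) - adjMat G).det = 0 := by
    by_contra hne
    rw [spectrum.mem_iff, Algebra.algebraMap_eq_smul_one] at hs
    exact hs ((Matrix.isUnit_iff_isUnit_det _).2 (isUnit_iff_ne_zero.2 hne))
  obtain ⟨v, hv0, hv⟩ := Matrix.exists_mulVec_eq_zero_iff.2 hdet
  have hva : ∀ a, ∑ b ∈ nb G a, v b = specRad G * v a := by
    intro a
    have h1 := congrFun hv a
    rw [Matrix.sub_mulVec, Matrix.smul_mulVec, Matrix.one_mulVec] at h1
    simp only [Pi.sub_apply, Pi.smul_apply, smul_eq_mul, adjMat_mulVec, Pi.zero_apply] at h1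
    linarith
  refine ⟨fun a => |v a|, fun a => abs_nonneg _, ?_, ?_⟩
  · intro h
    apply hv0
    funext a
    simpa using congrFun h a
  · apply eigen_of_quad_eq
    calc specRad G * ∑ a, |v a| ^ 2 = ∑ a, v a * ∑ b ∈ nb G a, v b := by
          rw [Finset.mul_sum]
          exact Finset.sum_congr rfl fun a _ => by rw [hva, sq_abs]; ring
      _ ≤ ∑ a, |v a| * ∑ b ∈ nb G a, |v b| := by
          refine Finset.sum_le_sum fun a _ => ?_
          calc v a * ∑ b ∈ nb G a, v b ≤ |v a| * |∑ b ∈ nb G a, v b| := by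
                rw [← abs_mul]; exact le_abs_self _
            _ ≤ _ := mul_le_mul_of_nonneg_left (Finset.abs_sum_le_sum_abs _ _) (abs_nonneg _)

omit [DecidableEq V] in
lemma eigenvector_pos {G : SimpleGraph V} (hG : G.Connected) {x : V → ℝ} {r : ℝ}
    (hx : ∀ a, 0 ≤ x a) (hx0 : x ≠ 0) (hr : ∀ a, ∑ b ∈ nb G a, x b = r * x a) (a : V) :
    0 < x a := by
  obtain ⟨s, hs⟩ : ∃ s, x s ≠ 0 := by
    by_contra h
    push Not at h
    exact hx0 (funext h)
  have hs' : 0 < x s := lt_of_le_of_ne (hx s) (Ne.symm hs)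
  obtain ⟨w⟩ := hG.preconnected s a
  clear hs
  induction w with
  | nil => exact hs'
  | @cons p q t hpq w ih =>
    refine ih ?_
    rcases (hx q).lt_or_eq with h | h
    · exact h
    · have h1 := hr q
      rw [← h, mul_zero, Finset.sum_eq_zero_iff_of_nonneg (fun b _ => hx b)] at h1
      have := h1 p (by simpa using hpq.symm)
      linarith

omit [DecidableEq V] in
lemma sum_mul_sum_nb_comm (G : SimpleGraph V) (x y : V → ℝ) :
    ∑ a, x a * ∑ b ∈ nb G a, y b = ∑ a, y a * ∑ b ∈ nb G a, x b := by
  classical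
  simp only [nb, Finset.sum_filter, Finset.mul_sum]
  rw [Finset.sum_comm]
  refine Finset.sum_congr rfl fun a _ => Finset.sum_congr rfl fun b _ => ?_
  simp only [G.adj_comm b a]
  split_ifs <;> ring

lemma specRad_eq_of_pos_eigenvector [Nonempty V] {G : SimpleGraph V} {y : V → ℝ} {r : ℝ}
    (hy : ∀ a, 0 < y a) (hr : ∀ a, ∑ b ∈ nb G a, y b = r * y a) : specRad G = r := by
  obtain ⟨x, hx, hx0, hxe⟩ := exists_nonneg_eigenvector G
  have h := sum_mul_sum_nb_comm G x y
  have e1 : ∑ a, x a * ∑ b ∈ nb G a, y b = r * ∑ a, x a * y a := by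
    rw [Finset.mul_sum]
    exact Finset.sum_congr rfl fun a _ => by rw [hr]; ring
  have e2 : ∑ a, y a * ∑ b ∈ nb G a, x b = specRad G * ∑ a, x a * y a := by
    rw [Finset.mul_sum]
    exact Finset.sum_congr rfl fun a _ => by rw [hxe]; ring
  have hpos : 0 < ∑ a, x a * y a := by
    obtain ⟨s, hs⟩ : ∃ s, x s ≠ 0 := by
      by_contra h
      push Not at h
      exact hx0 (funext h)
    exact Finset.sum_pos' (fun a _ => mul_nonneg (hx a) (hy a).le)
      ⟨s, Finset.mem_univ _, mul_pos (lt_of_le_of_ne (hx s) (Ne.symm hs)) (hy s)⟩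
  have : specRad G * ∑ a, x a * y a = r * ∑ a, x a * y a := by rw [← e1, ← e2, h]
  exact mul_right_cancel₀ hpos.ne' this

end Spectral

section Cut

variable {U : Type*}

/-- Every edge `ab` lies in an edge cut separating `a` from `b` which contains at most one
further edge. -/
def CutProp (H : SimpleGraph U) : Prop :=
  ∀ a b, H.Adj a b → ∃ (S : Set U) (f : Sym2 U), a ∈ S ∧ b ∉ S ∧
    ∀ c ∈ S, ∀ d ∉ S, H.Adj c d → s(c, d) = s(a, b) ∨ s(c, d) = f

/-- Every edge `ab` lies in two edge cuts separating `a` from `b`, each containing at most one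
further edge, with distinct further edges. -/
def CutProp2 (H : SimpleGraph U) : Prop :=
  ∀ a b, H.Adj a b → ∃ (S S' : Set U) (f f' : Sym2 U), f ≠ f' ∧
    (a ∈ S ∧ b ∉ S ∧ ∀ c ∈ S, ∀ d ∉ S, H.Adj c d → s(c, d) = s(a, b) ∨ s(c, d) = f) ∧
    (a ∈ S' ∧ b ∉ S' ∧ ∀ c ∈ S', ∀ d ∉ S', H.Adj c d → s(c, d) = s(a, b) ∨ s(c, d) = f')

lemma CutProp2.cutProp {H : SimpleGraph U} (h : CutProp2 H) : CutProp H := by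
  intro a b hab
  obtain ⟨S, _, f, _, _, h1, _⟩ := h a b hab
  exact ⟨S, f, h1⟩

lemma cut_path_two {H : SimpleGraph U} {S : Set U} {f : Sym2 U} {a b c : U}
    (ha : a ∈ S) (hb : b ∉ S)
    (hS : ∀ c ∈ S, ∀ d ∉ S, H.Adj c d → s(c, d) = s(a, b) ∨ s(c, d) = f)
    (h1 : H.Adj a c) (h2 : H.Adj c b) : f = s(a, c) ∨ f = s(c, b) := by
  have n1 := h1.ne
  have n2 := h2.ne
  by_cases hc : c ∈ S
  · rcases hS c hc b hb h2 with h | h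
    · simp at h; grind
    · exact Or.inr h.symm
  · rcases hS a ha c hc h1 with h | h
    · simp at h; grind
    · exact Or.inl h.symm

lemma cut_path_three {H : SimpleGraph U} {S : Set U} {f : Sym2 U} {a b c d : U}
    (ha : a ∈ S) (hb : b ∉ S)
    (hS : ∀ c ∈ S, ∀ d ∉ S, H.Adj c d → s(c, d) = s(a, b) ∨ s(c, d) = f)
    (h1 : H.Adj a c) (h2 : H.Adj c d) (h3 : H.Adj d b) (hcb : c ≠ b) (hda : d ≠ a) :
    f = s(a, c) ∨ f = s(c, d) ∨ f = s(d, b) := by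
  have n1 := h1.ne
  have n2 := h2.ne
  have n3 := h3.ne
  by_cases hc : c ∈ S
  · by_cases hd : d ∈ S
    · rcases hS d hd b hb h3 with h | h
      · simp at h; grind
      · exact Or.inr (Or.inr h.symm)
    · rcases hS c hc d hd h2 with h | h
      · simp at h; grind
      · exact Or.inr (Or.inl h.symm)
  · rcases hS a ha c hc h1 with h | h
    · simp at h; grind
    · exact Or.inl h.symm

lemma CutProp.edge_common_unique {H : SimpleGraph U} (h : CutProp H) {t a v v' : U}
    (hta : H.Adj t a) (h1 : H.Adj t v) (h2 : H.Adj v a) (h3 : H.Adj t v') (h4 : H.Adj v' a) :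
    v = v' := by
  obtain ⟨S, f, ha, hb, hS⟩ := h t a hta
  have e1 := cut_path_two ha hb hS h1 h2
  have e2 := cut_path_two ha hb hS h3 h4
  have := hta.ne; have := h1.ne; have := h2.ne; have := h3.ne; have := h4.ne
  by_contra hne
  rcases e1 with e1 | e1 <;> rcases e2 with e2 | e2 <;> rw [e1] at e2 <;>
    simp at e2 <;> grind

lemma CutProp.no_triangle {H : SimpleGraph U} (h : CutProp H) {t z v a g : U}
    (hzt : z ≠ t) (hz : ¬ H.Adj t z) (htv : H.Adj t v) (hvz : H.Adj v z) (hta : H.Adj t a)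
    (haz : H.Adj a z) (hva : v ≠ a) (htg : H.Adj t g) (hgv : H.Adj g v) : False := by
  by_cases hga : g = a
  · subst hga
    exact hzt (h.edge_common_unique hgv haz hvz.symm htg.symm htv)
  obtain ⟨S, f, ha, hb, hS⟩ := h t v htv
  have e1 := cut_path_two ha hb hS htg hgv
  have e2 := cut_path_three ha hb hS hta haz hvz.symm (Ne.symm hva) hzt
  have := htv.ne; have := hta.ne; have := hvz.ne; have := haz.ne; have := htg.ne
  have := hgv.ne
  have : g ≠ z := by rintro rfl; exact hz htg
  rcases e1 with e1 | e1 <;> rcases e2 with e2 | e2 | e2 <;> rw [e1] at e2 <;>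
    simp at e2 <;> grind

lemma cut_two_paths {H : SimpleGraph U} {S : Set U} {f : Sym2 U} {t v a a' z z' : U}
    (ha : t ∈ S) (hb : v ∉ S)
    (hS : ∀ c ∈ S, ∀ d ∉ S, H.Adj c d → s(c, d) = s(t, v) ∨ s(c, d) = f)
    (hzt : z ≠ t) (hz : ¬ H.Adj t z) (hzt' : z' ≠ t) (hz' : ¬ H.Adj t z')
    (htv : H.Adj t v) (hta : H.Adj t a) (hta' : H.Adj t a')
    (hvz : H.Adj v z) (haz : H.Adj a z) (hvz' : H.Adj v z') (haz' : H.Adj a' z')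
    (hva : v ≠ a) (hva' : v ≠ a') :
    (z = z' ∧ f = s(z, v)) ∨ (a = a' ∧ f = s(t, a)) ∨ (a = a' ∧ z = z') := by
  have e1 := cut_path_three ha hb hS hta haz hvz.symm (Ne.symm hva) hzt
  have e2 := cut_path_three ha hb hS hta' haz' hvz'.symm (Ne.symm hva') hzt'
  have := htv.ne; have := hta.ne; have := hta'.ne
  have : a ≠ z' := by rintro rfl; exact hz' hta
  have : a' ≠ z := by rintro rfl; exact hz hta'
  have : v ≠ z' := by rintro rfl; exact hz' htv
  have : v ≠ z := by rintro rfl; exact hz htv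
  rcases e1 with e1 | e1 | e1 <;> rcases e2 with e2 | e2 | e2 <;> rw [e1] at e2 <;>
    simp at e2 <;> grind

lemma CutProp.common_eq {H : SimpleGraph U} (h : CutProp H) {t v a a' z z' : U}
    (hzt : z ≠ t) (hz : ¬ H.Adj t z) (hzt' : z' ≠ t) (hz' : ¬ H.Adj t z') (hzz : z ≠ z')
    (htv : H.Adj t v) (hta : H.Adj t a) (hta' : H.Adj t a')
    (hvz : H.Adj v z) (haz : H.Adj a z) (hvz' : H.Adj v z') (haz' : H.Adj a' z')
    (hva : v ≠ a) (hva' : v ≠ a') : a = a' := by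
  obtain ⟨S, f, ha, hb, hS⟩ := h t v htv
  have := cut_two_paths ha hb hS hzt hz hzt' hz' htv hta hta' hvz haz hvz' haz' hva hva'
  tauto

lemma CutProp2.no_three {H : SimpleGraph U} (h : CutProp2 H) {t z v a a' : U}
    (hzt : z ≠ t) (hz : ¬ H.Adj t z)
    (htv : H.Adj t v) (hta : H.Adj t a) (hta' : H.Adj t a')
    (hvz : H.Adj v z) (haz : H.Adj a z) (haz' : H.Adj a' z)
    (hva : v ≠ a) (hva' : v ≠ a') (haa : a ≠ a') : False := by
  obtain ⟨S, S', f, f', hne, ⟨ha, hb, hS⟩, ⟨ha', hb', hS'⟩⟩ := h t v htv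
  have e1 := cut_two_paths ha hb hS hzt hz hzt hz htv hta hta' hvz haz hvz haz' hva hva'
  have e2 := cut_two_paths ha' hb' hS' hzt hz hzt hz htv hta hta' hvz haz hvz haz' hva hva'
  rcases e1 with e1 | e1 | e1 <;> rcases e2 with e2 | e2 | e2 <;> grind

lemma CutProp2.no_two_two {H : SimpleGraph U} (h : CutProp2 H) {t z z' v a : U}
    (hzt : z ≠ t) (hz : ¬ H.Adj t z) (hzt' : z' ≠ t) (hz' : ¬ H.Adj t z') (hzz : z ≠ z')
    (htv : H.Adj t v) (hta : H.Adj t a) (hvz : H.Adj v z) (haz : H.Adj a z)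
    (hvz' : H.Adj v z') (haz' : H.Adj a z') (hva : v ≠ a) : False := by
  obtain ⟨S, S', f, f', hne, ⟨ha, hb, hS⟩, ⟨ha', hb', hS'⟩⟩ := h t v htv
  have e1 := cut_two_paths ha hb hS hzt hz hzt' hz' htv hta hta hvz haz hvz' haz' hva hva
  have e2 := cut_two_paths ha' hb' hS' hzt hz hzt' hz' htv hta hta hvz haz hvz' haz' hva hva
  grind

end Cut

section Count

variable {U : Type*} [Fintype U]

open Classical in
/-- The common neighbours of `t` and `z`. -/
noncomputable def com (H : SimpleGraph U) (t z : U) : Finset U :=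
  Finset.univ.filter (fun a => H.Adj t a ∧ H.Adj z a)

open Classical in
/-- The vertices different from and not adjacent to `t`. -/
noncomputable def nonNb (H : SimpleGraph U) (t : U) : Finset U :=
  Finset.univ.filter (fun z => z ≠ t ∧ ¬ H.Adj t z)

open Classical in
/-- The neighbours of `t` lying in a triangle with `t`. -/
noncomputable def triNb (H : SimpleGraph U) (t : U) : Finset U :=
  (nb H t).filter (fun a => (com H t a).Nonempty)

open Classical in
/-- The neighbours of `t` lying in no triangle with `t`. -/
noncomputable def freeNb (H : SimpleGraph U) (t : U) : Finset U :=
  (nb H t).filter (fun a => ¬ (com H t a).Nonempty)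

open Classical in
/-- The nonneighbours of `t` with at least three common neighbours. -/
noncomputable def hubs (H : SimpleGraph U) (t : U) : Finset U :=
  (nonNb H t).filter (fun z => 3 ≤ (com H t z).card)

open Classical in
/-- The nonneighbours of `t` with exactly two common neighbours. -/
noncomputable def twos (H : SimpleGraph U) (t : U) : Finset U :=
  (nonNb H t).filter (fun z => (com H t z).card = 2)

open Classical in
/-- The nonneighbours of `t` with at most one common neighbour. -/
noncomputable def ones (H : SimpleGraph U) (t : U) : Finset U :=
  (nonNb H t).filter (fun z => (com H t z).card ≤ 1)

open Classical in
/-- The neighbours of `t` in no triangle with `t` and not adjacent to a hub. -/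
noncomputable def restNb (H : SimpleGraph U) (t : U) : Finset U :=
  (freeNb H t).filter (fun a => ∀ z ∈ hubs H t, ¬ H.Adj z a)

variable {H : SimpleGraph U} {t z a : U}

@[simp] lemma mem_com : a ∈ com H t z ↔ H.Adj t a ∧ H.Adj z a := by simp [com]
@[simp] lemma mem_nonNb : z ∈ nonNb H t ↔ z ≠ t ∧ ¬ H.Adj t z := by simp [nonNb]
@[simp] lemma mem_triNb : a ∈ triNb H t ↔ H.Adj t a ∧ (com H t a).Nonempty := by simp [triNb]
@[simp] lemma mem_freeNb : a ∈ freeNb H t ↔ H.Adj t a ∧ ¬ (com H t a).Nonempty := by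
  simp [freeNb]
@[simp] lemma mem_hubs :
    z ∈ hubs H t ↔ (z ≠ t ∧ ¬ H.Adj t z) ∧ 3 ≤ (com H t z).card := by simp [hubs]
@[simp] lemma mem_twos :
    z ∈ twos H t ↔ (z ≠ t ∧ ¬ H.Adj t z) ∧ (com H t z).card = 2 := by simp [twos]
@[simp] lemma mem_ones :
    z ∈ ones H t ↔ (z ≠ t ∧ ¬ H.Adj t z) ∧ (com H t z).card ≤ 1 := by simp [ones]
@[simp] lemma mem_restNb :
    a ∈ restNb H t ↔ a ∈ freeNb H t ∧ ∀ z ∈ hubs H t, ¬ H.Adj z a := by simp [restNb]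

lemma com_comm (H : SimpleGraph U) (t z : U) : com H t z = com H z t := by
  ext; simp [and_comm]

lemma sum_nb_eq (f : U → ℝ) :
    ∑ a ∈ nb H t, f a = ∑ a ∈ triNb H t, f a + ∑ a ∈ freeNb H t, f a :=
  (Finset.sum_filter_add_sum_filter_not _ _ _).symm

lemma card_nb_eq : (nb H t).card = (triNb H t).card + (freeNb H t).card :=
  (Finset.card_filter_add_card_filter_not _).symm

lemma sum_univ_eq (t : U) (f : U → ℝ) :
    ∑ a, f a = f t + ∑ a ∈ nb H t, f a + ∑ a ∈ nonNb H t, f a := by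
  classical
  rw [← Finset.add_sum_erase _ _ (Finset.mem_univ t), add_assoc]
  congr 1
  rw [← Finset.sum_filter_add_sum_filter_not (Finset.univ.erase t) (fun a => H.Adj t a)]
  congr 1
  · refine Finset.sum_congr ?_ fun _ _ => rfl
    ext a
    simp only [Finset.mem_filter, Finset.mem_erase, Finset.mem_univ, and_true, mem_nb]
    exact ⟨fun h => h.2, fun h => ⟨h.ne', h⟩⟩
  · refine Finset.sum_congr ?_ fun _ _ => rfl
    ext a
    simp

lemma card_univ_eq (H : SimpleGraph U) (t : U) :
    Fintype.card U = 1 + (nb H t).card + (nonNb H t).card := by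
  have h := sum_univ_eq (H := H) t (fun _ => (1 : ℝ))
  simp only [Finset.sum_const, Finset.card_univ, nsmul_eq_mul, mul_one] at h
  exact_mod_cast h

lemma sum_nonNb_eq (f : U → ℝ) :
    ∑ a ∈ nonNb H t, f a =
      ∑ a ∈ hubs H t, f a + ∑ a ∈ twos H t, f a + ∑ a ∈ ones H t, f a := by
  classical
  rw [← Finset.sum_filter_add_sum_filter_not (nonNb H t) (fun z => 3 ≤ (com H t z).card),
    ← Finset.sum_filter_add_sum_filter_not
      ((nonNb H t).filter (fun z => ¬ 3 ≤ (com H t z).card)) (fun z => (com H t z).card = 2),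
    ← add_assoc]
  congr 1
  · congr 1
    refine Finset.sum_congr ?_ fun _ _ => rfl
    ext
    simp only [Finset.mem_filter, mem_nonNb, mem_twos]
    constructor
    · rintro ⟨⟨h, -⟩, h'⟩; exact ⟨h, h'⟩
    · rintro ⟨h, h'⟩; exact ⟨⟨h, by omega⟩, h'⟩
  · refine Finset.sum_congr ?_ fun _ _ => rfl
    ext
    simp only [Finset.mem_filter, mem_nonNb, mem_ones]
    constructor
    · rintro ⟨⟨h, _⟩, h'⟩; exact ⟨h, by omega⟩
    · rintro ⟨h, h'⟩; exact ⟨⟨h, by omega⟩, by omega⟩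

lemma card_nonNb_eq : (nonNb H t).card =
    (hubs H t).card + (twos H t).card + (ones H t).card := by
  have h := sum_nonNb_eq (H := H) (t := t) (fun _ => (1 : ℝ))
  simp only [Finset.sum_const, nsmul_eq_mul, mul_one] at h
  exact_mod_cast h

lemma CutProp.card_com_le_one (h : CutProp H) (hta : H.Adj t a) : (com H t a).card ≤ 1 := by
  rw [Finset.card_le_one]
  intro v hv v' hv'
  rw [mem_com] at hv hv'
  exact h.edge_common_unique hta hv.1 hv.2.symm hv'.1 hv'.2.symm

lemma CutProp.card_com_triNb (h : CutProp H) (ha : a ∈ triNb H t) : (com H t a).card = 1 := by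
  rw [mem_triNb] at ha
  have h1 := h.card_com_le_one ha.1
  have h2 := ha.2.card_pos
  omega

lemma card_com_freeNb (ha : a ∈ freeNb H t) : (com H t a).card = 0 := by
  rw [mem_freeNb, Finset.not_nonempty_iff_eq_empty] at ha
  simp [ha.2]

lemma CutProp.com_subset_freeNb (h : CutProp H) (hz : z ≠ t) (hz' : ¬ H.Adj t z)
    (hc : 2 ≤ (com H t z).card) : com H t z ⊆ freeNb H t := by
  intro v hv
  obtain ⟨a, ha, hav⟩ := Finset.exists_mem_ne (s := com H t z) (by omega) v
  rw [mem_com] at hv ha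
  rw [mem_freeNb]
  refine ⟨hv.1, ?_⟩
  rintro ⟨g, hg⟩
  rw [mem_com] at hg
  exact h.no_triangle hz hz' hv.1 hv.2.symm ha.1 ha.2.symm hav.symm hg.1 hg.2.symm

lemma CutProp.disjoint_com (h : CutProp H) {z' : U} (hz : z ∈ hubs H t) (hz' : z' ≠ t)
    (hzt' : ¬ H.Adj t z') (hc : 2 ≤ (com H t z').card) (hzz : z ≠ z') :
    Disjoint (com H t z) (com H t z') := by
  classical
  rw [Finset.disjoint_left]
  intro v hv hv'
  obtain ⟨a', ha', hav'⟩ := Finset.exists_mem_ne (s := com H t z') (by omega) v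
  rw [mem_hubs] at hz
  have h2 : 1 < ((com H t z).erase v).card := by
    rw [Finset.card_erase_of_mem hv]; omega
  obtain ⟨a, ha, haa⟩ := Finset.exists_mem_ne h2 a'
  rw [Finset.mem_erase] at ha
  obtain ⟨hav, ha⟩ := ha
  rw [mem_com] at hv hv' ha ha'
  exact haa (h.common_eq hz.1.1 hz.1.2 hz' hzt' hzz hv.1 ha.1 ha'.1 hv.2.symm ha.2.symm
    hv'.2.symm ha'.2.symm hav.symm hav'.symm)

lemma CutProp.card_freeNb (h : CutProp H) (t : U) :
    (freeNb H t).card = ∑ z ∈ hubs H t, (com H t z).card + (restNb H t).card := by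
  classical
  rw [← Finset.card_biUnion]
  · rw [← Finset.card_filter_add_card_filter_not (s := freeNb H t)
      (fun a => ∀ z ∈ hubs H t, ¬ H.Adj z a), add_comm]
    congr 1
    refine congrArg Finset.card ?_
    ext a
    simp only [Finset.mem_filter, Finset.mem_biUnion]
    constructor
    · rintro ⟨h1, h2⟩
      push Not at h2
      obtain ⟨z, hz, hza⟩ := h2
      exact ⟨z, hz, mem_com.2 ⟨(mem_freeNb.1 h1).1, hza⟩⟩
    · rintro ⟨z, hz, hza⟩
      have hz1 := mem_hubs.1 hz
      refine ⟨h.com_subset_freeNb hz1.1.1 hz1.1.2 (by omega) hza, fun hh => ?_⟩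
      exact hh z hz (mem_com.1 hza).2
  · intro z hz z' hz' hzz
    have hz1 := mem_hubs.1 hz'
    exact h.disjoint_com hz hz1.1.1 hz1.1.2 (by omega) hzz

lemma CutProp.com_subset_restNb (h : CutProp H) (hz : z ∈ twos H t) :
    com H t z ⊆ restNb H t := by
  intro a ha
  have hz1 := mem_twos.1 hz
  rw [mem_restNb]
  refine ⟨h.com_subset_freeNb hz1.1.1 hz1.1.2 (by omega) ha, fun w hw hwa => ?_⟩
  have hne : w ≠ z := by
    rintro rfl
    have := mem_hubs.1 hw
    omega
  exact Finset.disjoint_left.1 (h.disjoint_com hw hz1.1.1 hz1.1.2 (by omega) hne)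
    (mem_com.2 ⟨(mem_com.1 ha).1, hwa⟩) ha

lemma CutProp.two_le_card_restNb (h : CutProp H) (hne : (twos H t).Nonempty) :
    2 ≤ (restNb H t).card := by
  obtain ⟨z, hz⟩ := hne
  have := Finset.card_le_card (h.com_subset_restNb hz)
  rw [(mem_twos.1 hz).2] at this
  exact this

/-- The weighted count of walks of length two from `t`. -/
lemma sum_walk_two (H : SimpleGraph U) (t : U) (x : U → ℝ) :
    ∑ a ∈ nb H t, ∑ z ∈ nb H a, x z = ∑ z, ((com H t z).card : ℝ) * x z := by
  classical
  simp only [nb, Finset.sum_filter, com]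
  have : ∀ a, (if H.Adj t a then ∑ z, (if H.Adj a z then x z else 0) else 0)
      = ∑ z, (if H.Adj t a ∧ H.Adj z a then x z else 0) := by
    intro a
    by_cases hta : H.Adj t a
    · simp [hta, H.adj_comm a]
    · simp [hta]
  simp only [this]
  rw [Finset.sum_comm]
  refine Finset.sum_congr rfl fun z _ => ?_
  rw [← Finset.sum_filter, Finset.sum_const, nsmul_eq_mul]

lemma com_self (H : SimpleGraph U) (t : U) : com H t t = nb H t := by ext; simp

lemma CutProp.sum_com (h : CutProp H) (t : U) (x : U → ℝ) :
    ∑ z, ((com H t z).card : ℝ) * x z =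
      (nb H t).card * x t + ∑ z ∈ triNb H t, x z + ∑ z ∈ nonNb H t, (com H t z).card * x z := by
  rw [sum_univ_eq (H := H) t, sum_nb_eq]
  have h3 : ∑ a ∈ triNb H t, ((com H t a).card : ℝ) * x a = ∑ a ∈ triNb H t, x a :=
    Finset.sum_congr rfl fun a ha => by rw [h.card_com_triNb ha]; simp
  have h4 : ∑ a ∈ freeNb H t, ((com H t a).card : ℝ) * x a = 0 :=
    Finset.sum_eq_zero fun a ha => by rw [card_com_freeNb ha]; simp
  rw [com_self, h3, h4]
  ring

/-- The number of walks of length two from `t`. -/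
noncomputable def walks (H : SimpleGraph U) (t : U) : ℕ :=
  (nb H t).card + (triNb H t).card + ∑ z ∈ nonNb H t, (com H t z).card

lemma CutProp.walks_le (h : CutProp H) (t : U) :
    walks H t + 2 * (hubs H t).card + (restNb H t).card + (ones H t).card + 2 ≤
      2 * Fintype.card U := by
  have h1 : ∑ z ∈ nonNb H t, (com H t z).card ≤
      ∑ z ∈ hubs H t, (com H t z).card + 2 * (twos H t).card + (ones H t).card := by
    have e := sum_nonNb_eq (H := H) (t := t) (fun z => ((com H t z).card : ℝ))
    have e' : ∑ z ∈ nonNb H t, (com H t z).card = ∑ z ∈ hubs H t, (com H t z).card +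
        ∑ z ∈ twos H t, (com H t z).card + ∑ z ∈ ones H t, (com H t z).card := by
      exact_mod_cast e
    have e2 : ∑ z ∈ twos H t, (com H t z).card = 2 * (twos H t).card := by
      rw [Finset.sum_congr rfl (fun z hz => (mem_twos.1 hz).2)]
      simp [mul_comm]
    have e3 : ∑ z ∈ ones H t, (com H t z).card ≤ (ones H t).card := by
      simpa using Finset.sum_le_sum (fun z hz => (mem_ones.1 hz).2)
    omega
  have h2 := h.card_freeNb t
  have h3 := card_nonNb_eq (H := H) (t := t)
  have h4 := card_univ_eq H t
  have h5 := card_nb_eq (H := H) (t := t)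
  unfold walks
  omega

lemma CutProp.walks_eq (h : CutProp H) (t : U) :
    (walks H t : ℝ) = ∑ z, ((com H t z).card : ℝ) := by
  have := h.sum_com t (fun _ => 1)
  simp only [mul_one, Finset.sum_const, nsmul_eq_mul] at this
  rw [this]
  unfold walks
  push_cast
  ring

end Count

section Weighted

variable {U : Type*} [Fintype U]

/-- `x` is a nonnegative eigenvector, with maximal entry `1` at `u`, of the graph obtained
from `H` by attaching `p` pendant vertices (whose entries are `1 / r`) to the vertex `u`. -/
structure PendantEigen (H : SimpleGraph U) (u : U) (p : ℕ) (r : ℝ) (x : U → ℝ) : Prop where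
  nonneg : ∀ a, 0 ≤ x a
  le_one : ∀ a, x a ≤ 1
  at_root : x u = 1
  pos : 0 < r
  eigen : ∀ s, s ≠ u → ∑ b ∈ nb H s, x b = r * x s
  eigen_root : ∑ b ∈ nb H u, x b + p / r = r

variable {H : SimpleGraph U} {u : U} {p : ℕ} {r : ℝ} {x : U → ℝ}

lemma PendantEigen.sq_eq_of_not_adj (E : PendantEigen H u p r x) {t : U} (htu : t ≠ u)
    (hadj : ¬ H.Adj t u) : r ^ 2 * x t = ∑ z, ((com H t z).card : ℝ) * x z := by
  rw [← sum_walk_two, sq, mul_assoc, ← E.eigen t htu, Finset.mul_sum]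
  refine Finset.sum_congr rfl fun a ha => (E.eigen a ?_).symm
  rintro rfl
  exact hadj (mem_nb.1 ha)

lemma PendantEigen.sq_eq_of_adj (E : PendantEigen H u p r x) {t : U} (htu : t ≠ u)
    (hadj : H.Adj t u) : r ^ 2 * x t = ∑ z, ((com H t z).card : ℝ) * x z + p / r := by
  classical
  rw [← sum_walk_two, sq, mul_assoc, ← E.eigen t htu, Finset.mul_sum,
    ← Finset.add_sum_erase _ _ (mem_nb.2 hadj), ← Finset.add_sum_erase _ _ (mem_nb.2 hadj),
    E.at_root, mul_one]
  have h := E.eigen_root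
  have h2 : ∑ a ∈ (nb H t).erase u, r * x a = ∑ a ∈ (nb H t).erase u, ∑ b ∈ nb H a, x b :=
    Finset.sum_congr rfl fun a ha => (E.eigen a (Finset.ne_of_mem_erase ha)).symm
  rw [h2]
  linarith

lemma PendantEigen.sq_eq_root (E : PendantEigen H u p r x) :
    r ^ 2 = ∑ z, ((com H u z).card : ℝ) * x z + p := by
  rw [← sum_walk_two]
  have h := E.eigen_root
  have h2 : ∑ a ∈ nb H u, r * x a = ∑ a ∈ nb H u, ∑ b ∈ nb H a, x b :=
    Finset.sum_congr rfl fun a ha => (E.eigen a (mem_nb.1 ha).ne').symm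
  rw [← h2, ← Finset.mul_sum]
  have h3 : ∑ a ∈ nb H u, x a = r - p / r := by linarith
  have := E.pos.ne'
  rw [h3]
  field_simp
  ring

lemma PendantEigen.sum_com_le (E : PendantEigen H u p r x) (h : CutProp H) (t : U) {τ : ℝ}
    (hτ : ∀ z, z ≠ u → x z ≤ τ) :
    ∑ z, ((com H t z).card : ℝ) * x z ≤ walks H t * τ + (com H t u).card * (1 - τ) := by
  classical
  have h1 : ∀ z, ((com H t z).card : ℝ) * x z ≤ (com H t z).card * τ +
      (if z = u then (com H t u).card * (1 - τ) else 0) := by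
    intro z
    by_cases hz : z = u
    · subst hz
      simp only [E.at_root, if_true]
      linarith
    · simp only [hz, if_false, add_zero]
      exact mul_le_mul_of_nonneg_left (hτ z hz) (Nat.cast_nonneg _)
  refine (Finset.sum_le_sum fun z _ => h1 z).trans ?_
  rw [Finset.sum_add_distrib, ← Finset.sum_mul, ← h.walks_eq]
  simp

lemma card_le_of_not_mem {m : ℕ} (hU : Fintype.card U = m + 2) {s : Finset U} {a b : U}
    (hab : a ≠ b) (ha : a ∉ s) (hb : b ∉ s) : s.card ≤ m := by
  classical
  have h1 : (insert a (insert b s)).card ≤ Fintype.card U := Finset.card_le_univ _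
  rw [Finset.card_insert_of_notMem (by simp [hab, ha]), Finset.card_insert_of_notMem hb] at h1
  omega

lemma mem_of_card_eq {m : ℕ} (hU : Fintype.card U = m + 2) {s : Finset U} {a b z : U}
    (hab : a ≠ b) (ha : a ∉ s) (hb : b ∉ s) (hs : m ≤ s.card) (hza : z ≠ a) (hzb : z ≠ b) :
    z ∈ s := by
  classical
  have h1 : insert a (insert b s) = Finset.univ := by
    apply Finset.eq_univ_of_card
    refine le_antisymm (Finset.card_le_univ _) ?_
    rw [Finset.card_insert_of_notMem (by simp [hab, ha]), Finset.card_insert_of_notMem hb]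
    omega
  have : z ∈ insert a (insert b s) := h1 ▸ Finset.mem_univ z
  simpa [hza, hzb] using this

lemma PendantEigen.le_two_add_of_nb (E : PendantEigen H u p r x) {s : Finset U}
    (hs : s.card ≤ 2) (hN : nb H u ⊆ s) : r ≤ 2 + p / r := by
  have h1 : ∑ b ∈ nb H u, x b ≤ 2 := by
    calc ∑ b ∈ nb H u, x b ≤ ∑ b ∈ s, x b :=
          Finset.sum_le_sum_of_subset_of_nonneg hN fun _ _ _ => E.nonneg _
      _ ≤ ∑ b ∈ s, 1 := Finset.sum_le_sum fun b _ => E.le_one b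
      _ = s.card := by simp
      _ ≤ 2 := by exact_mod_cast hs
  linarith [E.eigen_root]

/-- The case in which the largest entry off the root is at a vertex sharing at least three
neighbours with the root. -/
lemma PendantEigen.structure_of_hub (E : PendantEigen H u p r x) (h : CutProp H) {m : ℕ}
    (hU : Fintype.card U = m + 2) (hm : 6 ≤ m) {μ : ℝ} (hμ : (μ - m) * (μ - m - p) = m ^ 2)
    (hμ2 : 2 * m + p / 2 ≤ μ) (hr : μ ≤ r ^ 2) {w : U} (hwu : w ≠ u) (huw : ¬ H.Adj u w)
    (hc : 3 ≤ (com H u w).card) (hmax : ∀ z, z ≠ u → x z ≤ x w) :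
    r ^ 2 = μ ∧ (∀ z, z ≠ u → z ≠ w → H.Adj u z ∧ H.Adj w z) ∧
      (∀ z z', z ≠ u → z ≠ w → z' ≠ u → z' ≠ w → ¬ H.Adj z z') := by
  have hsuff : (∀ z, z ≠ u → z ≠ w → H.Adj u z ∧ H.Adj w z) →
      (∀ z z', z ≠ u → z ≠ w → z' ≠ u → z' ≠ w → ¬ H.Adj z z') := by
    intro hz z z' h1 h2 h3 h4 hadj
    exact hwu.symm (h.edge_common_unique hadj (hz z h1 h2).1.symm (hz z' h3 h4).1
      (hz z h1 h2).2.symm (hz z' h3 h4).2)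
  have hm' : (6 : ℝ) ≤ m := by exact_mod_cast hm
  have hp0 : (0 : ℝ) ≤ p := Nat.cast_nonneg _
  have hy1 := E.le_one w
  have hy0 := E.nonneg w
  have hubU : 1 ≤ (hubs H u).card := Finset.card_pos.2 ⟨w, mem_hubs.2 ⟨⟨hwu, huw⟩, hc⟩⟩
  have hubW : 1 ≤ (hubs H w).card := Finset.card_pos.2
    ⟨u, mem_hubs.2 ⟨⟨hwu.symm, fun e => huw e.symm⟩, by rwa [com_comm]⟩⟩
  have hTu : walks H u ≤ 2 * m := by have := h.walks_le u; omega
  have hTw : walks H w ≤ 2 * m := by have := h.walks_le w; omega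
  have hd : (nb H u).card ≤ m := card_le_of_not_mem hU hwu (by simpa using huw) (by simp)
  have hcm : (com H u w).card ≤ m := card_le_of_not_mem hU hwu (by simp) (by simp)
  have b1 : r ^ 2 ≤ p + (nb H u).card + (2 * m - (nb H u).card) * x w := by
    have e1 := E.sum_com_le h u hmax
    rw [com_self] at e1
    have e2 : (walks H u : ℝ) ≤ 2 * m := by exact_mod_cast hTu
    have := E.sq_eq_root
    nlinarith
  have b2 : r ^ 2 * x w ≤ (com H u w).card + (2 * m - (com H u w).card) * x w := by
    have e1 := E.sum_com_le h w hmax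
    rw [com_comm] at e1
    have e2 : (walks H w : ℝ) ≤ 2 * m := by exact_mod_cast hTw
    have := E.sq_eq_of_not_adj hwu (fun e => huw e.symm)
    nlinarith
  have hd' : ((nb H u).card : ℝ) ≤ m := by exact_mod_cast hd
  have hcm' : ((com H u w).card : ℝ) ≤ m := by exact_mod_cast hcm
  set q := r ^ 2 with hq
  set y := x w with hy
  have b3 : q - m - p ≤ m * y := by nlinarith
  have b4 : (q - m) * y ≤ m := by nlinarith
  have hqm : 0 < q - m := by linarith
  have b5 : (q - m - p) * (q - m) ≤ m ^ 2 := by nlinarith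
  have hqμ : q = μ := by
    by_contra hne
    have hlt : μ < q := lt_of_le_of_ne hr (Ne.symm hne)
    nlinarith
  refine ⟨hqμ, ?_⟩
  have hp2 : (q - m - p) * (q - m) = m ^ 2 := by rw [hqμ, ← hμ]; ring
  have c1 : m * y = q - m - p := by
    refine le_antisymm ?_ b3
    by_contra hlt
    push Not at hlt
    nlinarith
  have c2 : (q - m) * y = m := by
    refine le_antisymm b4 ?_
    by_contra hlt
    push Not at hlt
    nlinarith
  suffices hmain : ∀ z, z ≠ u → z ≠ w → H.Adj u z ∧ H.Adj w z from ⟨hmain, hsuff hmain⟩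
  rcases hy1.lt_or_eq with hlt | heq
  · have hcm2 : m ≤ (com H u w).card := by
      have : (m : ℝ) ≤ (com H u w).card := by
        by_contra hcon
        push Not at hcon
        nlinarith
      exact_mod_cast this
    intro z hzu hzw
    exact mem_com.1 (mem_of_card_eq hU hwu (by simp) (by simp) hcm2 hzw hzu)
  · rw [heq] at c1 c2
    have hq2 : q = 2 * m := by linarith
    have hp0' : (p : ℝ) = 0 := by linarith
    have hroot := E.sq_eq_root
    rw [← hq, hq2, hp0', add_zero, h.sum_com, E.at_root] at hroot
    have hc1 : ∑ z ∈ nonNb H u, ((com H u z).card : ℝ) * x z ≤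
        ∑ z ∈ nonNb H u, ((com H u z).card : ℝ) :=
      Finset.sum_le_sum fun z _ => mul_le_of_le_one_right (Nat.cast_nonneg _) (E.le_one z)
    have ht1 : ∑ z ∈ triNb H u, x z ≤ (triNb H u).card := by
      simpa using Finset.sum_le_sum fun z (_ : z ∈ triNb H u) => E.le_one z
    have hwalk : (walks H u : ℝ) =
        (nb H u).card + (triNb H u).card + ∑ z ∈ nonNb H u, ((com H u z).card : ℝ) := by
      unfold walks; push_cast; ring
    have hTu' : (walks H u : ℝ) ≤ 2 * m := by exact_mod_cast hTu
    have hTu2 : 2 * m ≤ walks H u := by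
      have : (2 * m : ℝ) ≤ walks H u := by linarith
      exact_mod_cast this
    have hcount := h.walks_le u
    have hrest : (restNb H u).card = 0 := by omega
    have htwos : (twos H u).card = 0 := by
      by_contra hne
      have := h.two_le_card_restNb (Finset.card_pos.1 (Nat.pos_of_ne_zero hne))
      omega
    have hnon : (nonNb H u).card = 1 := by
      have := card_nonNb_eq (H := H) (t := u)
      omega
    have hnon' : ∀ z, z ≠ u → ¬ H.Adj u z → z = w := by
      intro z h1 h2
      exact Finset.card_le_one.1 hnon.le z (mem_nonNb.2 ⟨h1, h2⟩) w (mem_nonNb.2 ⟨hwu, huw⟩)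
    have hone : ∀ v ∈ triNb H u, x v = 1 := by
      intro v hv
      by_contra hne
      have hlt : x v < 1 := lt_of_le_of_ne (E.le_one v) hne
      have : ∑ z ∈ triNb H u, x z < ∑ z ∈ triNb H u, 1 :=
        Finset.sum_lt_sum (fun z _ => E.le_one z) ⟨v, hv, hlt⟩
      simp only [Finset.sum_const, nsmul_eq_mul, mul_one] at this
      linarith
    have htri : triNb H u = ∅ := by
      classical
      rw [Finset.eq_empty_iff_forall_notMem]
      intro v hv
      have hv1 := mem_triNb.1 hv
      have hsub : nb H v ⊆ insert u (com H u v) := by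
        intro z hz
        rw [mem_nb] at hz
        by_cases hzu : z = u
        · simp [hzu]
        · by_cases huz : H.Adj u z
          · exact Finset.mem_insert_of_mem (mem_com.2 ⟨huz, hz⟩)
          · exfalso
            obtain rfl := hnon' z hzu huz
            have := h.com_subset_freeNb hwu huw (by omega) (mem_com.2 ⟨hv1.1, hz.symm⟩)
            exact (mem_freeNb.1 this).2 hv1.2
      have e1 := E.eigen v hv1.1.ne'
      rw [hone v hv, mul_one] at e1
      have e2 : ∑ b ∈ nb H v, x b ≤ 2 := by
        calc ∑ b ∈ nb H v, x b ≤ ∑ b ∈ insert u (com H u v), x b :=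
              Finset.sum_le_sum_of_subset_of_nonneg hsub fun _ _ _ => E.nonneg _
          _ ≤ ∑ b ∈ insert u (com H u v), 1 := Finset.sum_le_sum fun b _ => E.le_one b
          _ = ((insert u (com H u v)).card : ℝ) := by simp
          _ ≤ 2 := by
            have := Finset.card_insert_le u (com H u v)
            rw [h.card_com_triNb hv] at this
            exact_mod_cast this
      have : q ≤ 4 := by
        rw [hq]
        nlinarith [E.pos]
      linarith
    intro z hzu hzw
    have huz : H.Adj u z := by
      by_contra hcon
      exact hzw (hnon' z hzu hcon)
    refine ⟨huz, ?_⟩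
    by_contra hwz
    have : z ∈ restNb H u := by
      rw [mem_restNb, mem_freeNb]
      refine ⟨⟨huz, fun hne => ?_⟩, fun z' hz' => ?_⟩
      · have : z ∈ triNb H u := mem_triNb.2 ⟨huz, hne⟩
        rw [htri] at this
        simp at this
      · have := mem_hubs.1 hz'
        obtain rfl := hnon' z' this.1.1 this.1.2
        exact hwz
    rw [Finset.card_eq_zero.1 hrest] at this
    simp at this

end Weighted

section Weighted

variable {U : Type*} [Fintype U] {H : SimpleGraph U} {u : U} {p : ℕ} {r : ℝ} {x : U → ℝ}

lemma PendantEigen.sum_le_card_mul (E : PendantEigen H u p r x) {τ : ℝ} (hτ1 : τ ≤ 1)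
    (hτ : ∀ z, z ≠ u → x z ≤ τ) (s : Finset U) : ∑ z ∈ s, x z ≤ s.card * τ + (1 - τ) := by
  classical
  have h1 : ∀ z ∈ s, x z ≤ τ + (if z = u then 1 - τ else 0) := by
    intro z _
    by_cases hz : z = u
    · subst hz
      simp [E.at_root]
    · simpa [hz] using hτ z hz
  refine (Finset.sum_le_sum h1).trans ?_
  rw [Finset.sum_add_distrib, Finset.sum_const, nsmul_eq_mul, Finset.sum_ite_eq']
  split_ifs <;> linarith

lemma PendantEigen.bounds (E : PendantEigen H u p r x) {m : ℕ} (hm : 3 * p + 6 ≤ m)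
    (hr : 2 * m + (p : ℝ) / 2 ≤ r ^ 2) :
    3.46 ≤ r ∧ (p : ℝ) / r ≤ 0.154 * r ∧ (p : ℝ) / r ≤ 0.29 * p := by
  have hm' : 3 * (p : ℝ) + 6 ≤ m := by exact_mod_cast hm
  have hp0 : (0 : ℝ) ≤ p := Nat.cast_nonneg _
  have hr0 := E.pos
  have h1 : 3.46 ≤ r := by
    by_contra hcon
    push Not at hcon
    nlinarith
  refine ⟨h1, ?_, ?_⟩
  · rw [div_le_iff₀ hr0]; nlinarith
  · rw [div_le_iff₀ hr0]; nlinarith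

lemma PendantEigen.five_sevenths_le (E : PendantEigen H u p r x) (h : CutProp H) {m : ℕ}
    (hU : Fintype.card U = m + 2) (hm : 3 * p + 6 ≤ m) (hr : 2 * m + (p : ℝ) / 2 ≤ r ^ 2) {τ : ℝ}
    (hτ0 : 0 ≤ τ) (hτ1 : τ ≤ 1) (hτ : ∀ z, z ≠ u → x z ≤ τ) : 5 / 7 ≤ τ := by
  have hm' : 3 * (p : ℝ) + 6 ≤ m := by exact_mod_cast hm
  have hp0 : (0 : ℝ) ≤ p := Nat.cast_nonneg _
  have e1 := E.sum_com_le h u hτ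
  rw [com_self] at e1
  have e2 := E.sq_eq_root
  have e3 : ((nb H u).card : ℝ) ≤ m + 1 := by
    have := card_univ_eq H u
    have : (nb H u).card ≤ m + 1 := by omega
    exact_mod_cast this
  have e4 : (walks H u : ℝ) ≤ 2 * m + 2 := by
    have := h.walks_le u
    have : walks H u ≤ 2 * m + 2 := by omega
    exact_mod_cast this
  have e5 : (walks H u : ℝ) * τ ≤ (2 * m + 2) * τ := mul_le_mul_of_nonneg_right e4 hτ0
  have e6 : ((nb H u).card : ℝ) * (1 - τ) ≤ (m + 1) * (1 - τ) :=
    mul_le_mul_of_nonneg_right e3 (by linarith)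
  by_contra hcon
  push Not at hcon
  nlinarith

lemma PendantEigen.exists_three_mem_nb (E : PendantEigen H u p r x) {m : ℕ}
    (hm : 3 * p + 6 ≤ m) (hr : 2 * m + (p : ℝ) / 2 ≤ r ^ 2) {s : Finset U}
    (hs : s.card ≤ 2) : ¬ nb H u ⊆ s := by
  intro hN
  have h1 := E.le_two_add_of_nb hs hN
  obtain ⟨h2, h3, _⟩ := E.bounds hm hr
  linarith

/-- Walks of length two from any nonroot vertex are few if there are no hubs or twos. -/
lemma PendantEigen.hubs_or_twos (E : PendantEigen H u p r x) (h : CutProp H) {m : ℕ}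
    (hU : Fintype.card U = m + 2) (hm : 3 * p + 6 ≤ m) (hr : 2 * m + (p : ℝ) / 2 ≤ r ^ 2) {t : U}
    (htu : t ≠ u) (hmax : ∀ z, z ≠ u → x z ≤ x t) (hsq : r ^ 2 * x t ≤
      ∑ z, ((com H t z).card : ℝ) * x z + p / r) :
    (hubs H t).card ≠ 0 ∨ (twos H t).card ≠ 0 := by
  by_contra hcon
  push Not at hcon
  obtain ⟨hh, h2⟩ := hcon
  have hp0 : (0 : ℝ) ≤ p := Nat.cast_nonneg _
  have hτ1 := E.le_one t
  have hτ := E.five_sevenths_le h hU hm hr (E.nonneg t) hτ1 hmax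
  obtain ⟨b1, b2, b3⟩ := E.bounds hm hr
  rw [h.sum_com] at hsq
  have e1 : ∑ z ∈ triNb H t, x z ≤ r * x t := by
    rw [← E.eigen t htu, sum_nb_eq]
    have : 0 ≤ ∑ z ∈ freeNb H t, x z := Finset.sum_nonneg fun _ _ => E.nonneg _
    linarith
  have e2 : ∑ z ∈ nonNb H t, ((com H t z).card : ℝ) * x z ≤
      (nonNb H t).card * x t + (1 - x t) := by
    refine le_trans ?_ (E.sum_le_card_mul hτ1 hmax (nonNb H t))
    refine Finset.sum_le_sum fun z hz => ?_
    have : (com H t z).card ≤ 1 := by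
      by_contra hc
      rcases Nat.lt_or_ge 2 (com H t z).card with h3 | h3
      · have : z ∈ hubs H t := mem_hubs.2 ⟨mem_nonNb.1 hz, h3⟩
        rw [Finset.card_eq_zero.1 hh] at this
        simp at this
      · have : z ∈ twos H t := mem_twos.2 ⟨mem_nonNb.1 hz, by omega⟩
        rw [Finset.card_eq_zero.1 h2] at this
        simp at this
    have : ((com H t z).card : ℝ) ≤ 1 := by exact_mod_cast this
    exact mul_le_of_le_one_left (E.nonneg z) this
  have e3 : ((nb H t).card : ℝ) + (nonNb H t).card = m + 1 := by
    have := card_univ_eq H t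
    have : (nb H t).card + (nonNb H t).card = m + 1 := by omega
    exact_mod_cast this
  have e4 : r ^ 2 * x t ≤ (m + 1) * x t + r * x t + (1 - x t) + 0.154 * r := by
    rw [← e3]; linarith
  have e5 : r ^ 2 ≤ (m + 1) + r + 0.4 + 0.2156 * r := by
    by_contra hlt
    push Not at hlt
    nlinarith
  nlinarith

lemma PendantEigen.root_not_mem_triNb (E : PendantEigen H u p r x) (h : CutProp H) {m : ℕ}
    (hm : 3 * p + 6 ≤ m) (hr : 2 * m + (p : ℝ) / 2 ≤ r ^ 2) {t : U}
    (hones : (ones H t).card = 0) : u ∉ triNb H t := by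
  classical
  intro hu
  have hu1 := mem_triNb.1 hu
  refine E.exists_three_mem_nb hm hr (s := insert t (com H t u)) ?_ ?_
  · have := Finset.card_insert_le t (com H t u)
    rw [h.card_com_triNb hu] at this
    exact this
  · intro z hz
    rw [mem_nb] at hz
    by_cases hzt : z = t
    · simp [hzt]
    · by_cases htz : H.Adj t z
      · exact Finset.mem_insert_of_mem (mem_com.2 ⟨htz, hz⟩)
      · exfalso
        have hc : 2 ≤ (com H t z).card := by
          by_contra hc
          have : z ∈ ones H t := mem_ones.2 ⟨⟨hzt, htz⟩, by omega⟩
          rw [Finset.card_eq_zero.1 hones] at this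
          simp at this
        have := h.com_subset_freeNb hzt htz hc (mem_com.2 ⟨hu1.1, hz.symm⟩)
        exact (mem_freeNb.1 this).2 hu1.2

lemma PendantEigen.false_of_one_hub (E : PendantEigen H u p r x) (h : CutProp H) {m : ℕ}
    (hm : 3 * p + 6 ≤ m) (hr : 2 * m + (p : ℝ) / 2 ≤ r ^ 2) {t : U} (htu : t ≠ u)
    (hhub : (hubs H t).card = 1) (htwos : (twos H t).card = 0) (hones : (ones H t).card = 0)
    (hc : (com H t u).card ≤ 2) : False := by
  classical
  have hnon : (nonNb H t).card = 1 := by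
    have := card_nonNb_eq (H := H) (t := t)
    omega
  have htri := E.root_not_mem_triNb h hm hr hones
  obtain ⟨w, hw⟩ := Finset.card_eq_one.1 hhub
  obtain ⟨w', hw'⟩ := Finset.card_eq_one.1 hnon
  have hww : w = w' := by
    have h1 : w ∈ hubs H t := by rw [hw]; simp
    have h2 : w ∈ nonNb H t := mem_nonNb.2 (mem_hubs.1 h1).1
    rw [hw'] at h2
    simpa using h2
  subst hww
  by_cases hadj : H.Adj t u
  · refine E.exists_three_mem_nb hm hr (s := {t, w}) Finset.card_le_two ?_
    intro z hz
    rw [mem_nb] at hz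
    by_cases hzt : z = t
    · simp [hzt]
    · by_cases htz : H.Adj t z
      · exfalso
        exact htri (mem_triNb.2 ⟨hadj, z, mem_com.2 ⟨htz, hz⟩⟩)
      · have : z ∈ nonNb H t := mem_nonNb.2 ⟨hzt, htz⟩
        rw [hw'] at this
        simp at this
        simp [this]
  · have h1 : u ∈ nonNb H t := mem_nonNb.2 ⟨htu.symm, hadj⟩
    rw [hw', ← hw, mem_hubs] at h1
    omega

lemma PendantEigen.false_of_two_rest (E : PendantEigen H u p r x) (h : CutProp H) {m : ℕ}
    (hU : Fintype.card U = m + 2)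
    (hm : 3 * p + 6 ≤ m) (hr : 2 * m + (p : ℝ) / 2 ≤ r ^ 2) {t : U} (htu : t ≠ u)
    (hmax : ∀ z, z ≠ u → x z ≤ x t)
    (hsq : r ^ 2 * x t ≤ ∑ z, ((com H t z).card : ℝ) * x z + p / r)
    (hhub : (hubs H t).card = 0) (hrest : (restNb H t).card = 2)
    (hones : (ones H t).card = 0) : False := by
  classical
  have hp0 : (0 : ℝ) ≤ p := Nat.cast_nonneg _
  have hτ1 := E.le_one t
  have hτ := E.five_sevenths_le h hU hm hr (E.nonneg t) hτ1 hmax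
  obtain ⟨b1, b2, b3⟩ := E.bounds hm hr
  have htri := E.root_not_mem_triNb h hm hr hones
  have hfree : (freeNb H t).card = 2 := by
    rw [h.card_freeNb, Finset.card_eq_zero.1 hhub, hrest]
    simp
  have htwo : ∀ z, z ≠ t → ¬ H.Adj t z → com H t z = freeNb H t ∧ (com H t z).card = 2 := by
    intro z h1 h2
    have hc : (com H t z).card = 2 := by
      rcases Nat.lt_trichotomy (com H t z).card 2 with h3 | h3 | h3
      · have : z ∈ ones H t := mem_ones.2 ⟨⟨h1, h2⟩, by omega⟩
        rw [Finset.card_eq_zero.1 hones] at this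
        simp at this
      · exact h3
      · have : z ∈ hubs H t := mem_hubs.2 ⟨⟨h1, h2⟩, by omega⟩
        rw [Finset.card_eq_zero.1 hhub] at this
        simp at this
    exact ⟨Finset.eq_of_subset_of_card_le (h.com_subset_freeNb h1 h2 hc.ge) (by omega), hc⟩
  have htri_le : ∀ a ∈ triNb H t, r * x a ≤ 2 * x t := by
    intro a ha
    have ha1 := mem_triNb.1 ha
    have hau : a ≠ u := by rintro rfl; exact htri ha
    rw [← E.eigen a hau]
    obtain ⟨b, hb⟩ := Finset.card_eq_one.1 (h.card_com_triNb ha)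
    have hb1 : b ∈ com H t a := by rw [hb]; simp
    rw [mem_com] at hb1
    have hbu : b ≠ u := by
      rintro rfl
      exact htri (mem_triNb.2 ⟨hb1.1, a, mem_com.2 ⟨ha1.1, hb1.2.symm⟩⟩)
    have hsub : nb H a ⊆ {t, b} := by
      intro z hz
      rw [mem_nb] at hz
      by_cases hzt : z = t
      · simp [hzt]
      · by_cases htz : H.Adj t z
        · have : z ∈ com H t a := mem_com.2 ⟨htz, hz⟩
          rw [hb] at this
          simp at this
          simp [this]
        · exfalso
          have h1 : a ∈ freeNb H t := by
            rw [← (htwo z hzt htz).1]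
            exact mem_com.2 ⟨ha1.1, hz.symm⟩
          exact (mem_freeNb.1 h1).2 ha1.2
    calc ∑ z ∈ nb H a, x z ≤ ∑ z ∈ {t, b}, x z :=
          Finset.sum_le_sum_of_subset_of_nonneg hsub fun _ _ _ => E.nonneg _
      _ = x t + x b := Finset.sum_pair hb1.1.ne
      _ ≤ 2 * x t := by linarith [hmax b hbu]
  have hW1 : ∑ z ∈ nonNb H t, x z ≤ (r - 1) * x t := by
    obtain ⟨v, hv, hvu⟩ := Finset.exists_mem_ne (s := freeNb H t) (by omega) u
    have hv1 := mem_freeNb.1 hv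
    have hsub : insert t (nonNb H t) ⊆ nb H v := by
      intro z hz
      rw [Finset.mem_insert] at hz
      rcases hz with rfl | hz
      · exact mem_nb.2 hv1.1.symm
      · rw [mem_nonNb] at hz
        rw [← (htwo z hz.1 hz.2).1, mem_com] at hv
        exact mem_nb.2 hv.2.symm
    have h1 : ∑ z ∈ insert t (nonNb H t), x z ≤ r * x v := by
      rw [← E.eigen v hvu]
      exact Finset.sum_le_sum_of_subset_of_nonneg hsub fun _ _ _ => E.nonneg _
    rw [Finset.sum_insert (by simp)] at h1
    nlinarith [hmax v hvu, E.pos]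
  have hW2 := E.sum_le_card_mul hτ1 hmax (nonNb H t)
  rw [h.sum_com] at hsq
  have hWs : ∑ z ∈ nonNb H t, ((com H t z).card : ℝ) * x z = 2 * ∑ z ∈ nonNb H t, x z := by
    rw [Finset.mul_sum]
    refine Finset.sum_congr rfl fun z hz => ?_
    rw [mem_nonNb] at hz
    rw [(htwo z hz.1 hz.2).2]
    norm_num
  have hN : ((nb H t).card : ℝ) = (triNb H t).card + 2 := by
    have := card_nb_eq (H := H) (t := t)
    rw [hfree] at this
    exact_mod_cast this
  have hT : r * ∑ a ∈ triNb H t, x a ≤ 2 * (triNb H t).card * x t := by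
    rw [Finset.mul_sum]
    refine (Finset.sum_le_sum htri_le).trans ?_
    simp only [Finset.sum_const, nsmul_eq_mul]
    linarith
  have hcard : ((triNb H t).card : ℝ) + (nonNb H t).card = m - 1 := by
    have h1 := card_univ_eq H t
    have h2 := card_nb_eq (H := H) (t := t)
    have : (triNb H t).card + (nonNb H t).card + 1 = m := by omega
    rw [← this]
    push_cast
    ring
  rw [hWs, hN] at hsq
  set N := ((triNb H t).card : ℝ) with hNdef
  have hN0 : 0 ≤ N := Nat.cast_nonneg _
  set W := ((nonNb H t).card : ℝ)
  set X := ∑ a ∈ triNb H t, x a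
  set Y := ∑ z ∈ nonNb H t, x z
  set τ := x t
  have hX : X ≤ 0.58 * N * τ := by
    have : 0 ≤ N * τ := mul_nonneg hN0 (by linarith)
    by_contra hlt
    push Not at hlt
    nlinarith
  have hN2 : (triNb H t).card ≤ 1 := by
    by_contra hcon
    have : (2 : ℝ) ≤ N := by
      have : 2 ≤ (triNb H t).card := by omega
      rw [hNdef]
      exact_mod_cast this
    have e1 : r ^ 2 * τ ≤ (N + 2) * τ + 0.58 * N * τ + 2 * (W * τ + (1 - τ)) + 0.29 * p := by
      linarith
    have e2 : (2 * m + (p : ℝ) / 2) * τ ≤ r ^ 2 * τ :=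
      mul_le_mul_of_nonneg_right hr (by linarith)
    have e3 : W = m - 1 - N := by linarith
    rw [e3] at e1
    nlinarith
  have hN3 : N ≤ 1 := by
    rw [hNdef]
    exact_mod_cast hN2
  have e1 : r ^ 2 * τ ≤ (N + 2) * τ + 0.58 * N * τ + 2 * ((r - 1) * τ) + 0.154 * r := by
    linarith
  have e2 : r ^ 2 ≤ 1.58 + 2 * r + 0.2156 * r := by
    by_contra hlt
    push Not at hlt
    nlinarith
  nlinarith

/-- A nonroot vertex with maximal entry off the root shares at least three neighbours with the
root. -/
lemma PendantEigen.three_le_card_com (E : PendantEigen H u p r x) (h : CutProp H) {m : ℕ}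
    (hU : Fintype.card U = m + 2)
    (hm : 3 * p + 6 ≤ m) (hr : 2 * m + (p : ℝ) / 2 ≤ r ^ 2) {t : U} (htu : t ≠ u)
    (hmax : ∀ z, z ≠ u → x z ≤ x t) : 3 ≤ (com H t u).card := by
  by_contra hcon
  have hc : (com H t u).card ≤ 2 := by omega
  have hp0 : (0 : ℝ) ≤ p := Nat.cast_nonneg _
  have hτ1 := E.le_one t
  have hτ := E.five_sevenths_le h hU hm hr (E.nonneg t) hτ1 hmax
  obtain ⟨b1, b2, b3⟩ := E.bounds hm hr
  have hsq : r ^ 2 * x t ≤ ∑ z, ((com H t z).card : ℝ) * x z + p / r := by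
    by_cases hadj : H.Adj t u
    · exact (E.sq_eq_of_adj htu hadj).le
    · rw [E.sq_eq_of_not_adj htu hadj]
      have : 0 ≤ (p : ℝ) / r := div_nonneg hp0 E.pos.le
      linarith
  have hcount := h.walks_le t
  have hrest := h.two_le_card_restNb (t := t)
  have hcases := E.hubs_or_twos h hU hm hr htu hmax hsq
  have hk : 2 * (hubs H t).card + (restNb H t).card + (ones H t).card < 3 := by
    by_contra hk
    have e0 : walks H t + 1 ≤ 2 * m := by omega
    have e1 : (walks H t : ℝ) + 1 ≤ 2 * m := by exact_mod_cast e0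
    have e2 := E.sum_com_le h t hmax
    have e3 : ((com H t u).card : ℝ) ≤ 2 := by exact_mod_cast hc
    have e4 : ((com H t u).card : ℝ) * (1 - x t) ≤ 2 * (1 - x t) :=
      mul_le_mul_of_nonneg_right e3 (by linarith)
    have e5 : (walks H t : ℝ) * x t ≤ (2 * m - 1) * x t :=
      mul_le_mul_of_nonneg_right (by linarith) (by linarith)
    have e6 : (2 * m + (p : ℝ) / 2) * x t ≤ r ^ 2 * x t :=
      mul_le_mul_of_nonneg_right hr (by linarith)
    nlinarith
  have hrest' : (twos H t).card ≠ 0 → 2 ≤ (restNb H t).card := fun hne =>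
    hrest (Finset.card_pos.1 (Nat.pos_of_ne_zero hne))
  by_cases hh : (hubs H t).card = 0
  · have h2 : (twos H t).card ≠ 0 := by omega
    have h3 := hrest' h2
    exact E.false_of_two_rest h hU hm hr htu hmax hsq hh (by omega) (by omega)
  · have h2 : (twos H t).card = 0 := by
      by_contra hne
      have := hrest' hne
      omega
    exact E.false_of_one_hub h hm hr htu (by omega) h2 (by omega) hc

/-- The extremal structure theorem for graphs with the cut property and pendant vertices
attached to the root. -/
theorem PendantEigen.structure_thm (E : PendantEigen H u p r x) (h : CutProp H) {m : ℕ}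
    (hU : Fintype.card U = m + 2) (hm : 3 * p + 6 ≤ m) {μ : ℝ}
    (hμ : (μ - m) * (μ - m - p) = m ^ 2) (hμ2 : 2 * m + (p : ℝ) / 2 ≤ μ) (hr : μ ≤ r ^ 2) :
    r ^ 2 = μ ∧ ∃ w, w ≠ u ∧ ¬ H.Adj u w ∧ (∀ z, z ≠ u → z ≠ w → H.Adj u z ∧ H.Adj w z) ∧
      (∀ z z', z ≠ u → z ≠ w → z' ≠ u → z' ≠ w → ¬ H.Adj z z') := by
  classical
  have hne : (Finset.univ.erase u).Nonempty := by
    rw [← Finset.card_pos, Finset.card_erase_of_mem (Finset.mem_univ u), Finset.card_univ]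
    omega
  obtain ⟨w, hw, hmax⟩ := Finset.exists_max_image (Finset.univ.erase u) x hne
  have hwu : w ≠ u := Finset.ne_of_mem_erase hw
  have hmax' : ∀ z, z ≠ u → x z ≤ x w := fun z hz =>
    hmax z (Finset.mem_erase.2 ⟨hz, Finset.mem_univ _⟩)
  have hc := E.three_le_card_com h hU hm (hμ2.trans hr) hwu hmax'
  have huw : ¬ H.Adj u w := by
    intro hadj
    have := h.card_com_le_one hadj.symm
    omega
  rw [com_comm] at hc
  have := E.structure_of_hub h hU (by omega) hμ hμ2 hr hwu huw hc hmax'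
  exact ⟨this.1, w, hwu, huw, this.2⟩

end Weighted

section DoubleCut

variable {U : Type*} [Fintype U] {H : SimpleGraph U} {u : U} {r : ℝ} {x : U → ℝ}

lemma CutProp2.hubs_eq_empty (h : CutProp2 H) (t : U) : hubs H t = ∅ := by
  rw [Finset.eq_empty_iff_forall_notMem]
  intro z hz
  rw [mem_hubs] at hz
  obtain ⟨v, a, a', hv, ha, ha', h1, h2, h3⟩ := Finset.two_lt_card_iff.1 hz.2
  rw [mem_com] at hv ha ha'
  exact h.no_three hz.1.1 hz.1.2 hv.1 ha.1 ha'.1 hv.2.symm ha.2.symm ha'.2.symm h1 h2 h3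

lemma CutProp2.disjoint_com_twos (h : CutProp2 H) {t z z' : U} (hz : z ∈ twos H t)
    (hz' : z' ∈ twos H t) (hne : z ≠ z') : Disjoint (com H t z) (com H t z') := by
  rw [Finset.disjoint_left]
  intro v hv hv'
  rw [mem_twos] at hz hz'
  obtain ⟨a, ha, hav⟩ := Finset.exists_mem_ne (s := com H t z) (by omega) v
  obtain ⟨a', ha', hav'⟩ := Finset.exists_mem_ne (s := com H t z') (by omega) v
  rw [mem_com] at hv hv' ha ha'
  obtain rfl := h.cutProp.common_eq hz.1.1 hz.1.2 hz'.1.1 hz'.1.2 hne hv.1 ha.1 ha'.1 hv.2.symm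
    ha.2.symm hv'.2.symm ha'.2.symm hav.symm hav'.symm
  exact h.no_two_two hz.1.1 hz.1.2 hz'.1.1 hz'.1.2 hne hv.1 ha.1 hv.2.symm ha.2.symm hv'.2.symm
    ha'.2.symm hav.symm

lemma CutProp2.two_mul_card_twos_le (h : CutProp2 H) (t : U) :
    2 * (twos H t).card ≤ (freeNb H t).card := by
  classical
  have h1 : ((twos H t).biUnion (com H t)).card = 2 * (twos H t).card := by
    rw [Finset.card_biUnion fun z hz z' hz' => h.disjoint_com_twos hz hz',
      Finset.sum_congr rfl (fun z hz => (mem_twos.1 hz).2)]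
    simp [mul_comm]
  rw [← h1]
  refine Finset.card_le_card fun a ha => ?_
  rw [Finset.mem_biUnion] at ha
  obtain ⟨z, hz, ha⟩ := ha
  have hz1 := mem_twos.1 hz
  exact h.cutProp.com_subset_freeNb hz1.1.1 hz1.1.2 hz1.2.ge ha

/-- Graphs with the double cut property have small spectral radius. -/
theorem PendantEigen.false_of_cutProp2 (E : PendantEigen H u 0 r x) (h : CutProp2 H) {m p : ℕ}
    (hU : Fintype.card U = m + p + 2) (hm : 3 * p + 6 ≤ m)
    (hr : 2 * m + (p : ℝ) / 2 ≤ r ^ 2) : False := by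
  have hm' : 3 * (p : ℝ) + 6 ≤ m := by exact_mod_cast hm
  have hp0 : (0 : ℝ) ≤ p := Nat.cast_nonneg _
  have hr0 := E.pos
  have hr1 : 3.46 ≤ r := by
    by_contra hcon
    push Not at hcon
    nlinarith
  have hsq := E.sq_eq_root
  rw [h.cutProp.sum_com, E.at_root, sum_nonNb_eq, h.hubs_eq_empty, Finset.sum_empty] at hsq
  have e1 : ∑ z ∈ twos H u, ((com H u z).card : ℝ) * x z ≤ 2 * (twos H u).card := by
    calc ∑ z ∈ twos H u, ((com H u z).card : ℝ) * x z ≤ ∑ z ∈ twos H u, (2 : ℝ) := by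
          refine Finset.sum_le_sum fun z hz => ?_
          rw [(mem_twos.1 hz).2]
          push_cast
          linarith [E.le_one z]
      _ = _ := by simp [mul_comm]
  have e2 : ∑ z ∈ ones H u, ((com H u z).card : ℝ) * x z ≤ (ones H u).card := by
    calc ∑ z ∈ ones H u, ((com H u z).card : ℝ) * x z ≤ ∑ z ∈ ones H u, (1 : ℝ) := by
          refine Finset.sum_le_sum fun z hz => ?_
          have : ((com H u z).card : ℝ) ≤ 1 := by exact_mod_cast (mem_ones.1 hz).2
          exact mul_le_one₀ this (E.nonneg z) (E.le_one z)
      _ = _ := by simp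
  have hroot := E.eigen_root
  rw [sum_nb_eq] at hroot
  have h2 := h.two_mul_card_twos_le u
  have e3 : 2 * ((twos H u).card : ℝ) ≤ r * ∑ z ∈ freeNb H u, x z := by
    have h3 : ((freeNb H u).card : ℝ) ≤ r * ∑ z ∈ freeNb H u, x z := by
      rw [Finset.mul_sum]
      calc ((freeNb H u).card : ℝ) = ∑ z ∈ freeNb H u, (1 : ℝ) := by simp
        _ ≤ _ := by
          refine Finset.sum_le_sum fun z hz => ?_
          have hz1 := mem_freeNb.1 hz
          rw [← E.eigen z hz1.1.ne', ← E.at_root]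
          exact Finset.single_le_sum (f := x) (fun a _ => E.nonneg a) (mem_nb.2 hz1.1.symm)
    have h4 : 2 * ((twos H u).card : ℝ) ≤ (freeNb H u).card := by exact_mod_cast h2
    linarith
  have c1 := card_univ_eq H u
  have c2 := card_nb_eq (H := H) (t := u)
  have c3 := card_nonNb_eq (H := H) (t := u)
  rw [h.hubs_eq_empty, Finset.card_empty, zero_add] at c3
  have c4 : (nb H u).card + (twos H u).card + (ones H u).card = m + p + 1 := by omega
  have c4' : ((nb H u).card : ℝ) + (twos H u).card + (ones H u).card = m + p + 1 := by
    exact_mod_cast c4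
  have c5 : 3 * (twos H u).card ≤ m + p + 1 := by omega
  have c5' : 3 * ((twos H u).card : ℝ) ≤ m + p + 1 := by exact_mod_cast c5
  set X := ∑ z ∈ triNb H u, x z
  set Y := ∑ z ∈ freeNb H u, x z
  set q := ((twos H u).card : ℝ)
  have f1 : r ^ 2 ≤ (m + p + 1) + r - Y + q := by
    simp only [Nat.cast_zero, zero_div, add_zero] at hsq hroot
    linarith
  have f2 : r ^ 3 ≤ (m + p + 1) * r + r ^ 2 + q * (r - 2) := by nlinarith
  have f3 : q * (r - 2) ≤ (m + p + 1) / 3 * (r - 2) :=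
    mul_le_mul_of_nonneg_right (by linarith) (by linarith)
  have f4 : (m : ℝ) + p + 1 ≤ (8 * r ^ 2 - 5) / 13 := by linarith
  have f5 : ((m : ℝ) + p + 1) * (4 * r - 2) ≤ (8 * r ^ 2 - 5) / 13 * (4 * r - 2) :=
    mul_le_mul_of_nonneg_right f4 (by linarith)
  nlinarith [mul_nonneg (sub_nonneg.2 hr1) (sub_nonneg.2 hr1), sq_nonneg (r - 3.46),
    mul_nonneg (mul_nonneg (sub_nonneg.2 hr1) (sub_nonneg.2 hr1)) (sub_nonneg.2 hr1)]

end DoubleCut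

section Components

variable {V : Type*}

lemma mem_of_reachable {K : SimpleGraph V} {S : Set V}
    (hS : ∀ c ∈ S, ∀ d, K.Adj c d → d ∈ S) {a b : V} (ha : a ∈ S) (h : K.Reachable a b) :
    b ∈ S := by
  obtain ⟨w⟩ := h
  induction w with
  | nil => exact ha
  | cons hpq _ ih => exact ih (hS _ ha _ hpq)

lemma reachable_deleteEdge_or {G : SimpleGraph V} {a b s t : V} (h : G.Reachable s t) :
    (G.deleteEdges {s(a, b)}).Reachable s t ∨
      ((G.deleteEdges {s(a, b)}).Reachable s a ∧ (G.deleteEdges {s(a, b)}).Reachable b t) ∨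
      ((G.deleteEdges {s(a, b)}).Reachable s b ∧ (G.deleteEdges {s(a, b)}).Reachable a t) := by
  obtain ⟨w⟩ := h
  induction w with
  | nil => exact Or.inl (Reachable.refl _)
  | @cons p q t hpq _ ih =>
    by_cases he : s(p, q) = s(a, b)
    · rw [Sym2.eq_iff] at he
      rcases he with ⟨rfl, rfl⟩ | ⟨rfl, rfl⟩
      · rcases ih with ih | ih | ih
        · exact Or.inr (Or.inl ⟨Reachable.refl _, ih⟩)
        · exact Or.inr (Or.inl ⟨Reachable.refl _, ih.2⟩)
        · exact Or.inl ih.2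
      · rcases ih with ih | ih | ih
        · exact Or.inr (Or.inr ⟨Reachable.refl _, ih⟩)
        · exact Or.inl ih.2
        · exact Or.inr (Or.inr ⟨Reachable.refl _, ih.2⟩)
    · have h1 : (G.deleteEdges {s(a, b)}).Reachable p q :=
        Adj.reachable (by rw [deleteEdges_adj]; exact ⟨hpq, he⟩)
      rcases ih with ih | ih | ih
      · exact Or.inl (h1.trans ih)
      · exact Or.inr (Or.inl ⟨h1.trans ih.1, ih.2⟩)
      · exact Or.inr (Or.inr ⟨h1.trans ih.1, ih.2⟩)

variable [Finite V]

lemma card_connectedComponent_deleteEdge_le (G : SimpleGraph V) (e : Sym2 V) :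
    Nat.card (G.deleteEdges {e}).ConnectedComponent ≤ Nat.card G.ConnectedComponent + 1 := by
  classical
  induction e with | _ a b
  rw [← Finite.card_option]
  let K := G.deleteEdges {s(a, b)}
  let f : K.ConnectedComponent → Option G.ConnectedComponent := fun c =>
    if c = K.connectedComponentMk b then none
    else some (c.map (Hom.ofLE (deleteEdges_le _)))
  refine Nat.card_le_card_of_injective f ?_
  have hf : ∀ s, f (K.connectedComponentMk s) =
      if K.connectedComponentMk s = K.connectedComponentMk b then none
      else some (G.connectedComponentMk s) := fun s => rfl
  intro c c' h
  induction c using ConnectedComponent.ind with | _ s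
  induction c' using ConnectedComponent.ind with | _ t
  change f (K.connectedComponentMk s) = f (K.connectedComponentMk t) at h
  change K.connectedComponentMk s = K.connectedComponentMk t
  rw [hf, hf] at h
  by_cases h1 : K.connectedComponentMk s = K.connectedComponentMk b
  · by_cases h2 : K.connectedComponentMk t = K.connectedComponentMk b
    · rw [h1, h2]
    · simp [h1, h2] at h
  · by_cases h2 : K.connectedComponentMk t = K.connectedComponentMk b
    · simp [h1, h2] at h
    · rw [if_neg h1, if_neg h2] at h
      have h := ConnectedComponent.exact (Option.some.inj h)
      rw [ConnectedComponent.eq] at h1 h2 ⊢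
      rcases reachable_deleteEdge_or (a := a) (b := b) h with h3 | h3 | h3
      · exact h3
      · exact absurd h3.2.symm h2
      · exact absurd h3.1 h1

lemma card_connectedComponent_deleteEdges_le (G : SimpleGraph V) (F : Set (Sym2 V)) :
    Nat.card (G.deleteEdges F).ConnectedComponent ≤
      Nat.card G.ConnectedComponent + F.ncard := by
  induction F, F.toFinite using Set.Finite.induction_on with
  | empty => simp
  | @insert e F he _ ih =>
    rw [Set.ncard_insert_of_notMem he]
    have : G.deleteEdges (insert e F) = (G.deleteEdges F).deleteEdges {e} := by
      rw [deleteEdges_deleteEdges, Set.union_comm]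
      rfl
    rw [this]
    have := card_connectedComponent_deleteEdge_le (G.deleteEdges F) e
    omega

omit [Finite V] in
lemma card_connectedComponent_of_connected {G : SimpleGraph V} (hG : G.Connected) :
    Nat.card G.ConnectedComponent = 1 := by
  have := hG.preconnected.subsingleton_connectedComponent
  have := hG.nonempty
  exact Nat.card_unique

end Components

section EdgeConnectivity

variable {V : Type*}

/-- The set of bridges of a connected graph. -/
def bridgeSet (G : SimpleGraph V) : Set (Sym2 V) :=
  {e | e ∈ G.edgeSet ∧ ¬ (G.deleteEdges {e}).Connected}

lemma connected_deleteEdge_of_reachable {G : SimpleGraph V} (hG : G.Connected) {a b : V}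
    (h : (G.deleteEdges {s(a, b)}).Reachable a b) : (G.deleteEdges {s(a, b)}).Connected := by
  have := hG.nonempty
  refine ⟨fun s t => ?_⟩
  rcases reachable_deleteEdge_or (a := a) (b := b) (hG.preconnected s t) with h1 | h1 | h1
  · exact h1
  · exact h1.1.trans (h.trans h1.2)
  · exact h1.1.trans (h.symm.trans h1.2)

variable [Finite V]

omit [Finite V] in
lemma le_ncard_of_le_edgeConnL {G : SimpleGraph V} {k l : ℕ} (hl : l ≤ Nat.card V)
    (hk : k ≤ edgeConnL l G) {F : Set (Sym2 V)} (hF : F ⊆ G.edgeSet)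
    (hc : l ≤ Nat.card (G.deleteEdges F).ConnectedComponent) : k ≤ F.ncard := by
  rw [edgeConnL, if_pos hl] at hk
  exact hk.trans (Nat.sInf_le ⟨F, hF, rfl, hc⟩)

lemma exists_edges_of_edgeConnL_lt {G : SimpleGraph V} {k l : ℕ} (hl : l ≤ Nat.card V)
    (hk : edgeConnL l G < k) : ∃ F : Set (Sym2 V), F ⊆ G.edgeSet ∧ F.ncard < k ∧
      l ≤ Nat.card (G.deleteEdges F).ConnectedComponent := by
  rw [edgeConnL, if_pos hl] at hk
  have hne : {c : ℕ | ∃ F : Set (Sym2 V), F ⊆ G.edgeSet ∧ F.ncard = c ∧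
      l ≤ Nat.card (G.deleteEdges F).ConnectedComponent}.Nonempty := by
    refine ⟨_, G.edgeSet, subset_rfl, rfl, hl.trans ?_⟩
    refine Nat.card_le_card_of_injective (connectedComponentMk _) fun a b hab => ?_
    rw [ConnectedComponent.eq] at hab
    have : G.deleteEdges G.edgeSet = ⊥ := by
      ext a b
      simp
    rwa [this, reachable_bot] at hab
  obtain ⟨F, hF, hFc, hF'⟩ := Nat.sInf_mem hne
  exact ⟨F, hF, hFc ▸ hk, hF'⟩

/-- In a minimally `(k,k)`-edge-connected graph, every edge `e` that is not a bridge has many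
partners whose deletion, together with `e`, disconnects the graph. -/
lemma IsMinimallyKLEdgeConnected.exists_partners {G : SimpleGraph V} {k : ℕ}
    (hG : IsMinimallyKLEdgeConnected k k G) (hk : k ≤ Nat.card V) {e : Sym2 V}
    (he : e ∈ G.edgeSet) (he' : e ∉ bridgeSet G) :
    ∃ F : Set (Sym2 V), F ⊆ G.edgeSet \ {e} ∧ k ≤ F.ncard + 1 ∧
      ∀ f ∈ F, ¬ (G.deleteEdges {e, f}).Connected := by
  have hcon : (G.deleteEdges {e}).Connected := by
    by_contra hcon
    exact he' ⟨he, hcon⟩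
  obtain ⟨F, hF, hFk, hFc⟩ := exists_edges_of_edgeConnL_lt hk (hG.2.2 e he)
  have h1 := card_connectedComponent_deleteEdges_le (G.deleteEdges {e}) F
  rw [card_connectedComponent_of_connected hcon] at h1
  refine ⟨F, ?_, by omega, ?_⟩
  · rwa [edgeSet_deleteEdges] at hF
  · intro f hf hcf
    have h2 := card_connectedComponent_deleteEdges_le (G.deleteEdges {e, f}) (F \ {f})
    rw [card_connectedComponent_of_connected hcf, Set.ncard_sdiff_singleton_of_mem hf] at h2
    have h3 : (G.deleteEdges {e, f}).deleteEdges (F \ {f}) =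
        (G.deleteEdges {e}).deleteEdges F := by
      rw [deleteEdges_deleteEdges, deleteEdges_deleteEdges]
      congr 1
      ext g
      simp only [Set.mem_union, Set.mem_insert_iff, Set.mem_singleton_iff, Set.mem_sdiff]
      grind
    rw [h3] at h2
    have : 0 < F.ncard := (Set.ncard_pos F.toFinite).2 ⟨f, hf⟩
    omega

omit [Finite V] in
/-- Nonbridge partners of a nonbridge edge separate its ends. -/
lemma not_reachable_of_partner {G : SimpleGraph V} {a b : V} {f : Sym2 V}
    (hf : f ∈ G.edgeSet) (hf' : f ∉ bridgeSet G)
    (hcon : ¬ (G.deleteEdges {s(a, b), f}).Connected) :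
    ¬ (G.deleteEdges {s(a, b), f}).Reachable a b := by
  intro h
  have hc : (G.deleteEdges {f}).Connected := by
    by_contra hc
    exact hf' ⟨hf, hc⟩
  have e1 : G.deleteEdges {s(a, b), f} = (G.deleteEdges {f}).deleteEdges {s(a, b)} := by
    rw [deleteEdges_deleteEdges, Set.union_comm]
    rfl
  rw [e1] at h hcon
  exact hcon (connected_deleteEdge_of_reachable hc h)

omit [Finite V] in
/-- The reachability class of `a` after deleting a separating set of edges is a cut. -/
lemma cut_of_not_reachable {G : SimpleGraph V} {a b : V} {f : Sym2 V}
    (h : ¬ (G.deleteEdges {s(a, b), f}).Reachable a b) :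
    a ∈ {c | (G.deleteEdges {s(a, b), f}).Reachable a c} ∧
      b ∉ {c | (G.deleteEdges {s(a, b), f}).Reachable a c} ∧
      ∀ c ∈ {c | (G.deleteEdges {s(a, b), f}).Reachable a c},
      ∀ d ∉ {c | (G.deleteEdges {s(a, b), f}).Reachable a c}, G.Adj c d →
        s(c, d) = s(a, b) ∨ s(c, d) = f := by
  refine ⟨Reachable.refl _, h, fun c hc d hd hcd => ?_⟩
  by_contra hne
  refine hd (Reachable.trans hc (Adj.reachable ?_))
  rw [deleteEdges_adj]
  exact ⟨hcd, hne⟩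

omit [Finite V] in
lemma not_mem_edge_reachable {G : SimpleGraph V} (hG : G.Connected) {a b c : V}
    (hb : s(a, b) ∈ bridgeSet G) :
    ¬ (G.deleteEdges {s(a, b), s(c, c)}).Reachable a b := by
  intro h
  refine hb.2 (connected_deleteEdge_of_reachable hG (h.mono ?_))
  exact deleteEdges_anti (by simp)

/-- If there are at most `k - 3` bridges then the double cut property holds. -/
lemma IsMinimallyKLEdgeConnected.cutProp2 {G : SimpleGraph V} {k : ℕ}
    (hG : IsMinimallyKLEdgeConnected k k G) (hk : k ≤ Nat.card V)
    (hb : (bridgeSet G).ncard + 3 ≤ k) : CutProp2 G := by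
  intro a b hab
  by_cases he : s(a, b) ∈ bridgeSet G
  · refine ⟨_, _, s(a, a), s(b, b), ?_, cut_of_not_reachable (not_mem_edge_reachable hG.1 he),
      cut_of_not_reachable (not_mem_edge_reachable hG.1 he)⟩
    simpa using hab.ne
  · obtain ⟨F, hF, hFk, hFc⟩ := hG.exists_partners hk (mem_edgeSet G |>.2 hab) he
    have h1 : 1 < (F \ bridgeSet G).ncard := by
      have := Set.le_ncard_sdiff (bridgeSet G) F
      omega
    obtain ⟨f, f', hf, hf', hne⟩ := (Set.one_lt_ncard_iff).1 h1
    exact ⟨_, _, f, f', hne,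
      cut_of_not_reachable (not_reachable_of_partner (hF hf.1).1 hf.2 (hFc f hf.1)),
      cut_of_not_reachable (not_reachable_of_partner (hF hf'.1).1 hf'.2 (hFc f' hf'.1))⟩

end EdgeConnectivity

section FarDarts

variable {V : Type*} {G : SimpleGraph V} {u a v a' v' c d : V}

/-- A dart `(a, v)` along a bridge that points away from `u`. -/
def FarDart (G : SimpleGraph V) (u a v : V) : Prop :=
  G.Adj a v ∧ ¬ (G.deleteEdges {s(a, v)}).Reachable u v

/-- The set of far ends of bridges, as seen from `u`. -/
def farEnds (G : SimpleGraph V) (u : V) : Set V := {v | ∃ a, FarDart G u a v}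

/-- The graph obtained by deleting all bridges. -/
def bridgeless (G : SimpleGraph V) : SimpleGraph V := G.deleteEdges (bridgeSet G)

lemma bridgeless_adj : (bridgeless G).Adj c d ↔ G.Adj c d ∧ s(c, d) ∉ bridgeSet G := by
  rw [bridgeless, deleteEdges_adj]

lemma FarDart.cross (h : FarDart G u a v) (hc : (G.deleteEdges {s(a, v)}).Reachable u c)
    (hd : ¬ (G.deleteEdges {s(a, v)}).Reachable u d) (hcd : G.Adj c d) : c = a ∧ d = v := by
  by_cases he : s(c, d) = s(a, v)
  · rw [Sym2.eq_iff] at he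
    rcases he with he | ⟨rfl, rfl⟩
    · exact he
    · exact absurd hc h.2
  · exact absurd (hc.trans (Adj.reachable (by rw [deleteEdges_adj]; exact ⟨hcd, he⟩))) hd

lemma FarDart.reachable_fst (hG : G.Connected) (h : FarDart G u a v) :
    (G.deleteEdges {s(a, v)}).Reachable u a := by
  rcases reachable_deleteEdge_or (a := a) (b := v) (hG.preconnected u v) with h1 | h1 | h1
  · exact absurd h1 h.2
  · exact h1.1
  · exact absurd h1.1 h.2

lemma FarDart.mem_bridgeSet (h : FarDart G u a v) : s(a, v) ∈ bridgeSet G :=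
  ⟨h.1, fun hc => h.2 (hc.preconnected _ _)⟩

lemma FarDart.not_swap (hG : G.Connected) (h : FarDart G u a v) : ¬ FarDart G u v a := by
  intro h'
  have := h'.2
  rw [Sym2.eq_swap] at this
  exact this (h.reachable_fst hG)

lemma farDart_or_of_mem_bridgeSet (hG : G.Connected) (h : s(a, v) ∈ bridgeSet G) :
    FarDart G u a v ∨ FarDart G u v a := by
  have hav : G.Adj a v := h.1
  by_contra! hne
  have h1 : (G.deleteEdges {s(a, v)}).Reachable u v := by
    by_contra h1
    exact hne.1 ⟨hav, h1⟩
  have h2 : (G.deleteEdges {s(a, v)}).Reachable u a := by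
    by_contra h2
    exact hne.2 ⟨hav.symm, by rwa [Sym2.eq_swap]⟩
  exact h.2 (connected_deleteEdge_of_reachable hG (h2.symm.trans h1))

lemma FarDart.reachable_of_bridgeless (h : FarDart G u a v)
    (hc : (G.deleteEdges {s(a, v)}).Reachable u c) (hcd : (bridgeless G).Reachable c d) :
    (G.deleteEdges {s(a, v)}).Reachable u d := by
  refine mem_of_reachable (S := {c | (G.deleteEdges {s(a, v)}).Reachable u c})
    (fun c hc d hcd => ?_) hc hcd
  by_contra hd
  rw [bridgeless_adj] at hcd
  obtain ⟨rfl, rfl⟩ := h.cross hc hd hcd.1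
  exact hcd.2 h.mem_bridgeSet

lemma FarDart.not_reachable_root (h : FarDart G u a v) : ¬ (bridgeless G).Reachable u v :=
  fun h' => h.2 (h.reachable_of_bridgeless (Reachable.refl _) h')

lemma FarDart.eq_of_reachable (hG : G.Connected) (h : FarDart G u a v) (h' : FarDart G u a' v')
    (hr : (bridgeless G).Reachable v v') : a = a' ∧ v = v' := by
  by_contra hne
  have key : ∀ c ∈ {c | (G.deleteEdges {s(a, v)}).Reachable u c ∧
      (G.deleteEdges {s(a', v')}).Reachable u c}, ∀ d, G.Adj c d →
      d ∈ {c | (G.deleteEdges {s(a, v)}).Reachable u c ∧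
      (G.deleteEdges {s(a', v')}).Reachable u c} := by
    rintro c ⟨hc, hc'⟩ d hcd
    by_contra hd
    rw [Set.mem_ofPred_eq, not_and_or] at hd
    rcases hd with hd | hd
    · obtain ⟨rfl, rfl⟩ := h.cross hc hd hcd
      exact hne (h'.cross hc' (fun h1 => h'.2 (h'.reachable_of_bridgeless h1 hr)) hcd)
    · obtain ⟨rfl, rfl⟩ := h'.cross hc' hd hcd
      have := h.cross hc (fun h1 => h.2 (h.reachable_of_bridgeless h1 hr.symm)) hcd
      exact hne ⟨this.1.symm, this.2.symm⟩
  exact h.2 (mem_of_reachable key ⟨Reachable.refl u, Reachable.refl u⟩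
    (hG.preconnected u v)).1

lemma root_notMem_farEnds : u ∉ farEnds G u := fun ⟨_, h⟩ => h.2 (Reachable.refl _)

lemma eq_of_reachable_of_mem_insert (hG : G.Connected) (hv : v ∈ insert u (farEnds G u))
    (hv' : v' ∈ insert u (farEnds G u)) (hr : (bridgeless G).Reachable v v') : v = v' := by
  rcases hv with rfl | ⟨a, ha⟩ <;> rcases hv' with rfl | ⟨a', ha'⟩
  · rfl
  · exact absurd hr ha'.not_reachable_root
  · exact absurd hr.symm ha.not_reachable_root
  · exact (ha.eq_of_reachable hG ha' hr).2

lemma ncard_farEnds (hG : G.Connected) (u : V) :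
    (farEnds G u).ncard = (bridgeSet G).ncard := by
  have h1 : farEnds G u = Prod.snd '' {x : V × V | FarDart G u x.1 x.2} := by
    ext v
    simp [farEnds]
  have h2 : bridgeSet G = (fun x : V × V => s(x.1, x.2)) '' {x | FarDart G u x.1 x.2} := by
    ext e
    induction e with | _ a b
    constructor
    · intro h
      rcases farDart_or_of_mem_bridgeSet (u := u) hG h with h | h
      · exact ⟨(a, b), h, rfl⟩
      · exact ⟨(b, a), h, Sym2.eq_swap⟩
    · rintro ⟨⟨c, d⟩, h, he⟩
      rw [← he]
      exact h.mem_bridgeSet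
  rw [h1, h2, Set.InjOn.ncard_image, Set.InjOn.ncard_image]
  · rintro ⟨a, b⟩ h ⟨c, d⟩ h' he
    simp only [Set.mem_ofPred_eq] at h h'
    rcases Sym2.eq_iff.1 he with ⟨rfl, rfl⟩ | ⟨rfl, rfl⟩
    · rfl
    · exact absurd h' (h.not_swap hG)
  · rintro ⟨a, b⟩ h ⟨c, d⟩ h' he
    simp only [Set.mem_ofPred_eq] at h h' he
    subst he
    rw [(h.eq_of_reachable hG h' (Reachable.refl _)).1]

variable [Finite V]

lemma ncard_bridgeSet_lt_card_connectedComponent (hG : G.Connected) :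
    (bridgeSet G).ncard + 1 ≤ Nat.card (bridgeless G).ConnectedComponent := by
  obtain ⟨u⟩ := hG.nonempty
  rw [← ncard_farEnds hG u, ← Set.ncard_insert_of_notMem root_notMem_farEnds,
    ← Nat.card_coe_set_eq]
  refine Nat.card_le_card_of_injective
    (fun v : (insert u (farEnds G u) : Set V) => (bridgeless G).connectedComponentMk v) ?_
  intro v v' h
  exact Subtype.ext (eq_of_reachable_of_mem_insert hG v.2 v'.2 (ConnectedComponent.exact h))

lemma IsMinimallyKLEdgeConnected.ncard_bridgeSet_add_two_le {k : ℕ}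
    (hG : IsMinimallyKLEdgeConnected k k G) (hk : k ≤ Nat.card V) (hk2 : 2 ≤ k) :
    (bridgeSet G).ncard + 2 ≤ k := by
  by_contra! hlt
  obtain ⟨B, hB, hBc⟩ := Set.exists_subset_card_eq (s := bridgeSet G) (n := k - 1) (by omega)
  have h1 := ncard_bridgeSet_lt_card_connectedComponent hG.1
  have h2 := card_connectedComponent_deleteEdges_le (G.deleteEdges B) (bridgeSet G \ B)
  rw [deleteEdges_deleteEdges, Set.union_sdiff_cancel hB] at h2
  have h3 := Set.ncard_sdiff_add_ncard_of_subset hB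
  have h4 := le_ncard_of_le_edgeConnL hk hG.2.1 (fun e he => (hB he).1)
    (by rw [bridgeless] at h1; omega)
  omega

end FarDarts

section Pendants

variable {U P : Type*}

/-- The graph obtained from `H` by attaching the elements of `P` as pendant vertices at `s`. -/
def pend (P : Type*) (H : SimpleGraph U) (s : U) : SimpleGraph (U ⊕ P) where
  Adj
    | Sum.inl a, Sum.inl b => H.Adj a b
    | Sum.inl a, Sum.inr _ => a = s
    | Sum.inr _, Sum.inl b => b = s
    | Sum.inr _, Sum.inr _ => False
  symm := ⟨by
    rintro (a | z) (b | z') h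
    · exact Adj.symm h
    · exact h
    · exact h
    · exact h⟩
  loopless := ⟨by
    rintro (a | z) h
    · exact H.loopless.irrefl a h
    · exact h⟩

variable {H : SimpleGraph U} {s a b : U} {z z' : P}

@[simp] lemma pend_inl_inl : (pend P H s).Adj (Sum.inl a) (Sum.inl b) ↔ H.Adj a b := Iff.rfl
@[simp] lemma pend_inl_inr : (pend P H s).Adj (Sum.inl a) (Sum.inr z) ↔ a = s := Iff.rfl
@[simp] lemma pend_inr_inl : (pend P H s).Adj (Sum.inr z) (Sum.inl b) ↔ b = s := Iff.rfl
@[simp] lemma pend_inr_inr : ¬ (pend P H s).Adj (Sum.inr z) (Sum.inr z') := fun h => h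

variable [Fintype U] [Fintype P]

lemma sum_nb_pend_inl_of_ne (has : a ≠ s) (x : U ⊕ P → ℝ) :
    ∑ t ∈ nb (pend P H s) (Sum.inl a), x t = ∑ b ∈ nb H a, x (Sum.inl b) := by
  classical
  simp only [nb, Finset.sum_filter, Fintype.sum_sum_type, pend_inl_inl, pend_inl_inr, has,
    if_false, Finset.sum_const_zero, add_zero]

lemma sum_nb_pend_root (x : U ⊕ P → ℝ) : ∑ t ∈ nb (pend P H s) (Sum.inl s), x t =
    ∑ b ∈ nb H s, x (Sum.inl b) + ∑ z, x (Sum.inr z) := by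
  classical
  simp only [nb, Finset.sum_filter, Fintype.sum_sum_type, pend_inl_inl, pend_inl_inr, if_true]

lemma sum_nb_pend_inr (x : U ⊕ P → ℝ) (z : P) :
    ∑ t ∈ nb (pend P H s) (Sum.inr z), x t = x (Sum.inl s) := by
  classical
  simp [nb, Finset.sum_filter, Fintype.sum_sum_type]

lemma quad_pend (x : U ⊕ P → ℝ) : ∑ t, x t * ∑ t' ∈ nb (pend P H s) t, x t' =
    ∑ a, x (Sum.inl a) * ∑ b ∈ nb H a, x (Sum.inl b) +
      2 * x (Sum.inl s) * ∑ z, x (Sum.inr z) := by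
  classical
  have h1 : ∑ a, x (Sum.inl a) * ∑ t' ∈ nb (pend P H s) (Sum.inl a), x t' =
      ∑ a, x (Sum.inl a) * ∑ b ∈ nb H a, x (Sum.inl b) +
        x (Sum.inl s) * ∑ z, x (Sum.inr z) := by
    rw [← Finset.add_sum_erase _ _ (Finset.mem_univ s), sum_nb_pend_root,
      ← Finset.add_sum_erase (a := s) Finset.univ
        (fun a => x (Sum.inl a) * ∑ b ∈ nb H a, x (Sum.inl b)) (Finset.mem_univ s)]
    have h2 : ∑ a ∈ Finset.univ.erase s, x (Sum.inl a) *
        ∑ t' ∈ nb (pend P H s) (Sum.inl a), x t' = ∑ a ∈ Finset.univ.erase s,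
          x (Sum.inl a) * ∑ b ∈ nb H a, x (Sum.inl b) :=
      Finset.sum_congr rfl fun a ha => by
        rw [sum_nb_pend_inl_of_ne (Finset.ne_of_mem_erase ha)]
    rw [h2]
    ring
  rw [Fintype.sum_sum_type, h1]
  simp only [sum_nb_pend_inr, ← Finset.sum_mul]
  ring

lemma pendantEigen_of_pend {x : U ⊕ P → ℝ} {r : ℝ} (hr : 0 < r)
    (hx : ∀ t, 0 ≤ x t) (hs : 0 < x (Sum.inl s)) (hmax : ∀ a, x (Sum.inl a) ≤ x (Sum.inl s))
    (he : ∀ t, ∑ t' ∈ nb (pend P H s) t, x t' = r * x t) :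
    PendantEigen H s (Fintype.card P) r (fun a => x (Sum.inl a) / x (Sum.inl s)) where
  nonneg a := div_nonneg (hx _) hs.le
  le_one a := (div_le_one hs).2 (hmax a)
  at_root := div_self hs.ne'
  pos := hr
  eigen a ha := by
    rw [← Finset.sum_div, ← sum_nb_pend_inl_of_ne ha x, he, mul_div_assoc]
  eigen_root := by
    have h1 := he (Sum.inl s)
    have h2 : ∀ z : P, x (Sum.inr z) = x (Sum.inl s) / r := fun z => by
      rw [eq_div_iff hr.ne', mul_comm, ← he, sum_nb_pend_inr]
    rw [sum_nb_pend_root, Finset.sum_congr rfl fun z _ => h2 z, Finset.sum_const,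
      Finset.card_univ, nsmul_eq_mul] at h1
    rw [← Finset.sum_div, eq_sub_of_add_eq h1]
    field_simp
    ring

variable [DecidableEq U] [DecidableEq P]

/-- Attaching pendant vertices to any vertex of a graph with the cut property gives a graph of
spectral radius at most that of the extremal graph. -/
theorem specRad_pend_le (h : CutProp H) {m : ℕ} (hU : Fintype.card U = m + 2)
    (hm : 3 * Fintype.card P + 6 ≤ m) {μ : ℝ}
    (hμ : (μ - m) * (μ - m - Fintype.card P) = m ^ 2)
    (hμ2 : 2 * m + (Fintype.card P : ℝ) / 2 ≤ μ) (u : U) :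
    specRad (pend P H u) ≤ Real.sqrt μ := by
  have : Nonempty U := ⟨u⟩
  have hμ0 : 0 < μ := by
    have : (6 : ℝ) ≤ m := by exact_mod_cast (by omega : 6 ≤ m)
    have : (0 : ℝ) ≤ Fintype.card P := by positivity
    linarith
  obtain ⟨s, hs⟩ := Finite.exists_max fun s => specRad (pend P H s)
  refine (hs u).trans ?_
  by_contra! hlt
  have hr : 0 < specRad (pend P H s) := (Real.sqrt_nonneg _).trans_lt hlt
  obtain ⟨x, hx, hx0, he⟩ := exists_nonneg_eigenvector (pend P H s)
  obtain ⟨t, ht⟩ := Finite.exists_max fun a => x (Sum.inl a)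
  have hpos : 0 < x (Sum.inl t) := by
    refine (hx _).lt_of_ne' fun h0 => hx0 (funext ?_)
    have h1 : ∀ a, x (Sum.inl a) = 0 := fun a => le_antisymm (h0 ▸ ht a) (hx _)
    rintro (a | z)
    · exact h1 a
    · have := he (Sum.inr z)
      rw [sum_nb_pend_inr, h1] at this
      exact (mul_eq_zero.1 this.symm).resolve_left hr.ne'
  have hsum : 0 < ∑ a, x a ^ 2 :=
    Finset.sum_pos' (fun a _ => sq_nonneg _) ⟨Sum.inl t, Finset.mem_univ _, by positivity⟩
  have h1 : specRad (pend P H s) * ∑ a, x a ^ 2 ≤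
      ∑ a, x a * ∑ b ∈ nb (pend P H t) a, x b := by
    have : ∑ a, x a * ∑ b ∈ nb (pend P H s) a, x b = specRad (pend P H s) * ∑ a, x a ^ 2 := by
      rw [Finset.mul_sum]
      exact Finset.sum_congr rfl fun a _ => by rw [he]; ring
    rw [← this, quad_pend, quad_pend]
    have := mul_le_mul_of_nonneg_right (ht s)
      (Finset.sum_nonneg fun z _ => hx (Sum.inr z) : 0 ≤ ∑ z, x (Sum.inr z))
    linarith
  have h2 := quad_le_specRad (pend P H t) x
  have h3 : specRad (pend P H t) = specRad (pend P H s) :=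
    le_antisymm (hs t) (le_of_mul_le_mul_right (h1.trans h2) hsum)
  have h4 := eigen_of_quad_eq (pend P H t) x (by rw [h3]; exact h1)
  rw [h3] at h4
  have h5 := (pendantEigen_of_pend hr hx hpos ht h4).structure_thm h hU hm hμ hμ2
    ((Real.sqrt_le_left hr.le).1 hlt.le)
  rw [← h5.1, Real.sqrt_sq hr.le] at hlt
  exact lt_irrefl _ hlt

omit [Fintype P] [DecidableEq P] in
lemma nonempty_pend_iso_Kbook {m p : ℕ} (hU : Fintype.card U = m + 2) (eP : P ≃ Fin p)
    {u w : U} (hwu : w ≠ u) (huw : ¬ H.Adj u w)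
    (h1 : ∀ z, z ≠ u → z ≠ w → H.Adj u z ∧ H.Adj w z)
    (h2 : ∀ z z', z ≠ u → z ≠ w → z' ≠ u → z' ≠ w → ¬ H.Adj z z') :
    Nonempty (Kbook p m ≃g pend P H u) := by
  have hcard : Fintype.card {z // z ≠ u ∧ z ≠ w} = m := by
    rw [Fintype.card_subtype]
    have : Finset.univ.filter (fun z => z ≠ u ∧ z ≠ w) = (Finset.univ.erase u).erase w := by
      ext z
      simp [and_comm]
    rw [this, Finset.card_erase_of_mem (by simp [hwu]), Finset.card_erase_of_mem (by simp),
      Finset.card_univ, hU]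
    omega
  let eM : Fin m ≃ {z // z ≠ u ∧ z ≠ w} := (Fintype.equivFinOfCardEq hcard).symm
  let f : KbookV p m → U ⊕ P := fun t => match t with
    | Sum.inl (Sum.inl _) => Sum.inl u
    | Sum.inl (Sum.inr _) => Sum.inl w
    | Sum.inr (Sum.inl i) => Sum.inl (eM i)
    | Sum.inr (Sum.inr j) => Sum.inr (eP.symm j)
  have hf : Function.Bijective f := by
    constructor
    · rintro ((_ | _) | (i | j)) ((_ | _) | (i' | j')) h
      all_goals first | rfl | skip
      all_goals simp only [f, Sum.inl.injEq, Sum.inr.injEq, reduceCtorEq] at h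
      · exact absurd h.symm hwu
      · exact absurd h.symm (eM i').2.1
      · exact absurd h hwu
      · exact absurd h.symm (eM i').2.2
      · exact absurd h (eM i).2.1
      · exact absurd h (eM i).2.2
      · rw [eM.injective (Subtype.ext h)]
      · rw [eP.symm.injective h]
    · rintro (a | z)
      · by_cases ha : a = u
        · exact ⟨Sum.inl (Sum.inl ()), by simp [f, ha]⟩
        · by_cases haw : a = w
          · exact ⟨Sum.inl (Sum.inr ()), by simp [f, haw]⟩
          · exact ⟨Sum.inr (Sum.inl (eM.symm ⟨a, ha, haw⟩)), by simp [f]⟩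
      · exact ⟨Sum.inr (Sum.inr (eP z)), by simp [f]⟩
  refine ⟨⟨Equiv.ofBijective f hf, ?_⟩⟩
  have hu : ∀ i, H.Adj u (eM i) := fun i => (h1 _ (eM i).2.1 (eM i).2.2).1
  have hw : ∀ i, H.Adj w (eM i) := fun i => (h1 _ (eM i).2.1 (eM i).2.2).2
  have hM : ∀ i j, ¬ H.Adj (eM i) (eM j) := fun i j =>
    h2 _ _ (eM i).2.1 (eM i).2.2 (eM j).2.1 (eM j).2.2
  have hne : ∀ i, (eM i : U) ≠ u := fun i => (eM i).2.1
  have hwu' : ¬ H.Adj w u := fun h => huw h.symm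
  rintro ((_ | _) | (i | j)) ((_ | _) | (i' | j')) <;>
    simp [f, Kbook, SimpleGraph.fromRel_adj, hu, hw, hM, hne, hwu, huw, hwu',
      fun i => (hu i).symm, fun i => (hw i).symm]

end Pendants

section Collapse

variable {V : Type*} {G : SimpleGraph V} {u : V}

open Classical in
/-- The map collapsing all far ends of bridges to the root. -/
noncomputable def collapseFun (G : SimpleGraph V) (u v : V) : {v // v ∉ farEnds G u} :=
  if h : v ∈ farEnds G u then ⟨u, root_notMem_farEnds⟩ else ⟨v, h⟩

/-- The graph on the vertices that are not far ends of bridges, obtained by deleting all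
bridges and collapsing their far ends to the root. -/
def collapse (G : SimpleGraph V) (u : V) : SimpleGraph {v // v ∉ farEnds G u} where
  Adj s t := s ≠ t ∧ ∃ a b, (bridgeless G).Adj a b ∧ collapseFun G u a = s ∧
    collapseFun G u b = t
  symm := ⟨fun _ _ ⟨hne, a, b, hab, ha, hb⟩ => ⟨hne.symm, b, a, hab.symm, hb, ha⟩⟩
  loopless := ⟨fun _ h => h.1 rfl⟩

lemma collapseFun_of_notMem {v : V} (h : v ∉ farEnds G u) : collapseFun G u v = ⟨v, h⟩ := by
  rw [collapseFun, dif_neg h]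

lemma collapseFun_of_mem {v : V} (h : v ∈ farEnds G u) :
    collapseFun G u v = ⟨u, root_notMem_farEnds⟩ := by
  rw [collapseFun, dif_pos h]

lemma collapseFun_cases (a : V) : (collapseFun G u a).1 = a ∨
    (a ∈ farEnds G u ∧ (collapseFun G u a).1 = u) := by
  by_cases h : a ∈ farEnds G u
  · exact Or.inr ⟨h, by rw [collapseFun_of_mem h]⟩
  · exact Or.inl (by rw [collapseFun_of_notMem h])

lemma eq_or_mem_of_collapseFun_eq {a b : V} (h : collapseFun G u a = collapseFun G u b) :
    a = b ∨ (a ∈ insert u (farEnds G u) ∧ b ∈ insert u (farEnds G u)) := by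
  have h' : (collapseFun G u a).1 = (collapseFun G u b).1 := by rw [h]
  rcases collapseFun_cases (G := G) (u := u) a with ha | ⟨ha, ha'⟩ <;>
    rcases collapseFun_cases (G := G) (u := u) b with hb | ⟨hb, hb'⟩
  · exact Or.inl (by rw [← ha, h', hb])
  · exact Or.inr ⟨Or.inl (by rw [← ha, h', hb']), Or.inr hb⟩
  · exact Or.inr ⟨Or.inr ha, Or.inl (by rw [← hb, ← h', ha'])⟩
  · exact Or.inr ⟨Or.inr ha, Or.inr hb⟩

lemma collapse_adj_of_bridgeless (hG : G.Connected) {a b : V} (h : (bridgeless G).Adj a b) :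
    (collapse G u).Adj (collapseFun G u a) (collapseFun G u b) := by
  refine ⟨fun he => h.ne ?_, a, b, h, rfl, rfl⟩
  rcases eq_or_mem_of_collapseFun_eq he with he | ⟨ha, hb⟩
  · exact he
  · exact eq_of_reachable_of_mem_insert hG ha hb h.reachable

lemma collapseFun_injOn_darts (hG : G.Connected) {a b a' b' : V} (h : (bridgeless G).Adj a b)
    (h' : (bridgeless G).Adj a' b') (ha : collapseFun G u a = collapseFun G u a')
    (hb : collapseFun G u b = collapseFun G u b') : a = a' ∧ b = b' := by
  rcases eq_or_mem_of_collapseFun_eq ha with rfl | ⟨ha, ha'⟩ <;>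
    rcases eq_or_mem_of_collapseFun_eq hb with rfl | ⟨hb, hb'⟩
  · exact ⟨rfl, rfl⟩
  · exact ⟨rfl, eq_of_reachable_of_mem_insert hG hb hb' (h.symm.reachable.trans h'.reachable)⟩
  · exact ⟨eq_of_reachable_of_mem_insert hG ha ha' (h.reachable.trans h'.symm.reachable), rfl⟩
  · exact absurd (eq_of_reachable_of_mem_insert hG ha hb h.reachable) h.ne

lemma collapse_cut {f : Sym2 V} {a b : V}
    (hne : ¬ ((bridgeless G).deleteEdges {s(a, b), f}).Reachable a b)
    (hR : ∀ r ∈ insert u (farEnds G u),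
      ¬ ((bridgeless G).deleteEdges {s(a, b), f}).Reachable a r) :
    ∃ S : Set {v // v ∉ farEnds G u}, collapseFun G u a ∈ S ∧ collapseFun G u b ∉ S ∧
      ∀ c ∈ S, ∀ d ∉ S, (collapse G u).Adj c d →
        s(c, d) = s(collapseFun G u a, collapseFun G u b) ∨
        s(c, d) = f.map (collapseFun G u) := by
  set K := (bridgeless G).deleteEdges {s(a, b), f} with hK
  have key : ∀ c, K.Reachable a (collapseFun G u c).1 ↔ K.Reachable a c := by
    intro c
    rcases collapseFun_cases (G := G) (u := u) c with hc | ⟨hc, hc'⟩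
    · rw [hc]
    · rw [hc']
      exact ⟨fun h => absurd h (hR u (Or.inl rfl)), fun h => absurd h (hR c (Or.inr hc))⟩
  refine ⟨{c | K.Reachable a c.1}, (key a).2 (Reachable.refl _), fun h => hne ((key b).1 h), ?_⟩
  rintro c hc d hd ⟨-, a', b', hab, rfl, rfl⟩
  have ha' := (key a').1 hc
  have hb' : ¬ K.Reachable a b' := fun h => hd ((key b').2 h)
  by_contra! hcon
  refine hb' (ha'.trans (Adj.reachable ?_))
  rw [hK, deleteEdges_adj]
  refine ⟨hab, ?_⟩
  rintro (h | h)
  · exact hcon.1 (by simpa using congrArg (Sym2.map (collapseFun G u)) h)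
  · exact hcon.2 (by simpa using congrArg (Sym2.map (collapseFun G u)) h)

/-- When the number of bridges is at most `k - 2`, the collapsed graph has the cut property. -/
lemma IsMinimallyKLEdgeConnected.cutProp_collapse [Finite V] {k : ℕ}
    (hG : IsMinimallyKLEdgeConnected k k G) (hk : k ≤ Nat.card V)
    (hb : (bridgeSet G).ncard + 2 ≤ k) (u : V) : CutProp (collapse G u) := by
  rintro _ _ ⟨-, a, b, hab, rfl, rfl⟩
  have hab' := bridgeless_adj.1 hab
  obtain ⟨F, hF, hFk, hFc⟩ := hG.exists_partners hk (mem_edgeSet G |>.2 hab'.1) hab'.2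
  have h1 : 0 < (F \ bridgeSet G).ncard := by
    have := Set.le_ncard_sdiff (bridgeSet G) F
    omega
  obtain ⟨f, hf⟩ := (Set.ncard_pos (Set.toFinite _)).1 h1
  have hne : ¬ ((bridgeless G).deleteEdges {s(a, b), f}).Reachable a b := fun h =>
    not_reachable_of_partner (hF hf.1).1 hf.2 (hFc f hf.1)
      (h.mono (deleteEdges_mono (deleteEdges_le _)))
  by_cases hR : ∀ r ∈ insert u (farEnds G u),
      ¬ ((bridgeless G).deleteEdges {s(a, b), f}).Reachable a r
  · obtain ⟨S, hS⟩ := collapse_cut hne hR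
    exact ⟨S, _, hS⟩
  · push Not at hR
    obtain ⟨r, hr, har⟩ := hR
    have hR' : ∀ r ∈ insert u (farEnds G u),
        ¬ ((bridgeless G).deleteEdges {s(b, a), f}).Reachable b r := by
      intro r' hr' hbr
      rw [Sym2.eq_swap] at hbr
      have := eq_of_reachable_of_mem_insert hG.1 hr hr'
        ((har.symm.mono (deleteEdges_le _)).trans
          (hab.reachable.trans (hbr.mono (deleteEdges_le _))))
      exact hne (har.trans (this ▸ hbr.symm))
    have hne' : ¬ ((bridgeless G).deleteEdges {s(b, a), f}).Reachable b a := by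
      rw [Sym2.eq_swap]
      exact fun h => hne h.symm
    obtain ⟨S, hb, ha, hS⟩ := collapse_cut hne' hR'
    refine ⟨Sᶜ, f.map (collapseFun G u), ha, fun h => h hb, fun c hc d hd hcd => ?_⟩
    have := hS d (not_not.1 hd) c hc hcd.symm
    rwa [Sym2.eq_swap, Sym2.eq_swap (a := collapseFun G u a)]

end Collapse

section Comparison

variable {V : Type*} {G : SimpleGraph V} {u : V}

lemma mem_farEnds {v : V} : v ∈ farEnds G u ↔ ∃ a, FarDart G u a v := Iff.rfl

/-- An edge from the root to a far end of a bridge is itself a bridge pointing away from the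
root. -/
lemma farDart_of_adj_root {z : V} (hG : G.Connected) (hz : z ∈ farEnds G u) (h : G.Adj u z) :
    FarDart G u u z := by
  obtain ⟨a, ha⟩ := hz
  by_cases hb : s(u, z) ∈ bridgeSet G
  · refine (farDart_or_of_mem_bridgeSet hG hb).resolve_right fun h' => ?_
    exact h'.2 (Reachable.refl _)
  · exact absurd (Adj.reachable (bridgeless_adj.2 ⟨h, hb⟩)) ha.not_reachable_root

lemma bridgeless_adj_of_notMem {a b : V} (hG : G.Connected) (ha : a ∉ farEnds G u)
    (hb : b ∉ farEnds G u) (h : G.Adj a b) : (bridgeless G).Adj a b := by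
  refine bridgeless_adj.2 ⟨h, fun hbr => ?_⟩
  rcases farDart_or_of_mem_bridgeSet (u := u) hG hbr with h' | h'
  · exact hb ⟨_, h'⟩
  · exact ha ⟨_, h'⟩

open Classical in
/-- The vertices of `G` are the far ends of bridges and the other vertices. -/
noncomputable def farEquiv (G : SimpleGraph V) (u : V) :
    {v // v ∉ farEnds G u} ⊕ {v // v ∈ farEnds G u} ≃ V :=
  (Equiv.sumComm _ _).trans (Equiv.sumCompl (· ∈ farEnds G u))

@[simp] lemma farEquiv_inl (a : {v // v ∉ farEnds G u}) : farEquiv G u (Sum.inl a) = a := rfl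
@[simp] lemma farEquiv_inr (a : {v // v ∈ farEnds G u}) : farEquiv G u (Sum.inr a) = a := rfl

/-- The root, as a vertex of the collapsed graph. -/
def rootVertex (G : SimpleGraph V) (u : V) : {v // v ∉ farEnds G u} := ⟨u, root_notMem_farEnds⟩

/-- The graph obtained from the collapsed graph by reattaching the far ends of the bridges as
pendant vertices at the root. -/
abbrev collapsePend (G : SimpleGraph V) (u : V) :
    SimpleGraph ({v // v ∉ farEnds G u} ⊕ {v // v ∈ farEnds G u}) :=
  pend {v // v ∈ farEnds G u} (collapse G u) (rootVertex G u)

lemma collapsePend_adj_of_adj_root (hG : G.Connected)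
    {t : {v // v ∉ farEnds G u} ⊕ {v // v ∈ farEnds G u}} (h : G.Adj u (farEquiv G u t)) :
    (collapsePend G u).Adj (Sum.inl (rootVertex G u)) t := by
  rcases t with c | z
  · have := collapse_adj_of_bridgeless (u := u) hG
      (bridgeless_adj_of_notMem hG root_notMem_farEnds c.2 h)
    rwa [collapseFun_of_notMem root_notMem_farEnds, collapseFun_of_notMem c.2] at this
  · exact rfl

/-- If all neighbours of the root in the rearranged graph are neighbours in the original graph,
then the two graphs are isomorphic. -/
lemma nonempty_collapsePend_iso (hG : G.Connected)
    (h : ∀ t, (collapsePend G u).Adj (Sum.inl (rootVertex G u)) t → G.Adj u (farEquiv G u t)) :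
    Nonempty (collapsePend G u ≃g G) := by
  have hF : ∀ z ∈ farEnds G u, FarDart G u u z := fun z hz =>
    farDart_of_adj_root hG hz (h (Sum.inr ⟨z, hz⟩) rfl)
  have key : ∀ z ∈ farEnds G u, ∀ c, G.Adj z c → c = u := by
    intro z hz c hzc
    by_contra hcu
    have huz := hF z hz
    have hadj : G.Adj u c := by
      by_cases hbr : s(z, c) ∈ bridgeSet G
      · rcases farDart_or_of_mem_bridgeSet (u := u) hG hbr with h' | h'
        · exact (hF c ⟨z, h'⟩).1
        · exact absurd (h'.eq_of_reachable hG huz (Reachable.refl _)).1 hcu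
      · have hzc' : (bridgeless G).Adj z c := bridgeless_adj.2 ⟨hzc, hbr⟩
        have hc : c ∉ farEnds G u := fun hc => hzc.ne
          (eq_of_reachable_of_mem_insert hG (Or.inr hz) (Or.inr hc) hzc'.reachable)
        have := collapse_adj_of_bridgeless (u := u) hG hzc'
        rw [collapseFun_of_mem hz, collapseFun_of_notMem hc] at this
        exact h (Sum.inl ⟨c, hc⟩) this
    refine huz.2 ((Adj.reachable (v := c) ?_).trans (Adj.reachable ?_))
    · rw [deleteEdges_adj]
      refine ⟨hadj, fun he => ?_⟩
      rcases Sym2.eq_iff.1 he with he | he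
      · exact hzc.ne he.2.symm
      · exact hcu he.2
    · rw [deleteEdges_adj]
      refine ⟨hzc.symm, fun he => ?_⟩
      rcases Sym2.eq_iff.1 he with he | he
      · exact hcu he.1
      · exact hzc.ne he.1.symm
  have hbr : ∀ z ∈ farEnds G u, ∀ c, ¬ (bridgeless G).Adj z c := by
    intro z hz c hzc
    have hc := key z hz c (bridgeless_adj.1 hzc).1
    exact (hF z hz).not_reachable_root (hc ▸ hzc.symm.reachable)
  refine ⟨⟨farEquiv G u, ?_⟩⟩
  rintro (s | z) (t | z')
  · refine ⟨fun hst => ?_, ?_⟩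
    · have := collapse_adj_of_bridgeless (u := u) hG (bridgeless_adj_of_notMem hG s.2 t.2 hst)
      rwa [collapseFun_of_notMem s.2, collapseFun_of_notMem t.2] at this
    · rintro ⟨-, a, b, hab, rfl, rfl⟩
      have ha : a ∉ farEnds G u := fun ha => hbr a ha b hab
      have hb : b ∉ farEnds G u := fun hb => hbr b hb a hab.symm
      rw [collapseFun_of_notMem ha, collapseFun_of_notMem hb]
      exact (bridgeless_adj.1 hab).1
  · refine ⟨fun hst => Subtype.ext (key z' z'.2 s hst.symm), ?_⟩
    rintro rfl
    exact (hF z' z'.2).1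
  · refine ⟨fun hst => Subtype.ext (key z z.2 t hst), ?_⟩
    rintro rfl
    exact (hF z z.2).1.symm
  · refine ⟨fun hst => ?_, fun h => h.elim⟩
    have hz : (z' : V) = u := key z z.2 z' hst
    exact root_notMem_farEnds (hz ▸ z'.2)

variable [Fintype V]

lemma quad_eq_sum_darts [DecidableRel G.Adj] (x : V → ℝ) : ∑ a, x a * ∑ b ∈ nb G a, x b =
    ∑ d : V × V with G.Adj d.1 d.2, x d.1 * x d.2 := by
  classical
  rw [Finset.sum_filter, Fintype.sum_prod_type]
  refine Finset.sum_congr rfl fun a _ => ?_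
  rw [nb, Finset.sum_filter, Finset.mul_sum]
  exact Finset.sum_congr rfl fun b _ => by split_ifs <;> simp

omit [Fintype V] in
lemma le_collapseFun {x : V → ℝ} (hmax : ∀ a, x a ≤ x u) (a : V) :
    x a ≤ x (collapseFun G u a) := by
  rcases collapseFun_cases (G := G) (u := u) a with h | ⟨-, h⟩
  · rw [h]
  · rw [h]
    exact hmax a

lemma quad_bridgeless_le [Fintype {v // v ∉ farEnds G u}] (hG : G.Connected) {x : V → ℝ}
    (hx : ∀ a, 0 ≤ x a) (hmax : ∀ a, x a ≤ x u) :
    ∑ a, x a * ∑ b ∈ nb (bridgeless G) a, x b ≤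
      ∑ s : {v // v ∉ farEnds G u}, x s * ∑ t ∈ nb (collapse G u) s, x t := by
  classical
  rw [quad_eq_sum_darts, quad_eq_sum_darts (G := collapse G u) (fun s => x s)]
  let Φ : V × V → {v // v ∉ farEnds G u} × {v // v ∉ farEnds G u} :=
    Prod.map (collapseFun G u) (collapseFun G u)
  calc _ ≤ ∑ d : V × V with (bridgeless G).Adj d.1 d.2, x (Φ d).1 * x (Φ d).2 :=
        Finset.sum_le_sum fun d _ => mul_le_mul (le_collapseFun hmax _)
          (le_collapseFun hmax _) (hx _) (hx _)
    _ = ∑ e ∈ (Finset.univ.filter fun d : V × V => (bridgeless G).Adj d.1 d.2).image Φ,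
        x e.1 * x e.2 := by
        rw [Finset.sum_image]
        rintro ⟨a, b⟩ h ⟨a', b'⟩ h' he
        simp only [Finset.coe_filter, Finset.mem_univ, true_and, Set.mem_ofPred_eq] at h h'
        have he' := Prod.ext_iff.1 he
        obtain ⟨rfl, rfl⟩ := collapseFun_injOn_darts hG h h' he'.1 he'.2
        rfl
    _ ≤ _ := by
        refine Finset.sum_le_sum_of_subset_of_nonneg (fun e he => ?_)
          fun e _ _ => mul_nonneg (hx _) (hx _)
        obtain ⟨d, hd, rfl⟩ := Finset.mem_image.1 he
        simp only [Finset.mem_filter, Finset.mem_univ, true_and] at hd ⊢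
        exact collapse_adj_of_bridgeless hG hd

lemma sum_farDarts_le [Fintype {v // v ∈ farEnds G u}] [DecidablePred fun d : V × V =>
    FarDart G u d.1 d.2] (hG : G.Connected) {x : V → ℝ}
    (hx : ∀ a, 0 ≤ x a) (hmax : ∀ a, x a ≤ x u) :
    ∑ d : V × V with FarDart G u d.1 d.2, x d.1 * x d.2 ≤
      x u * ∑ z : {v // v ∈ farEnds G u}, x z := by
  classical
  have h1 : (Finset.univ.filter fun d : V × V => FarDart G u d.1 d.2).image Prod.snd =
      Finset.univ.filter (· ∈ farEnds G u) := by
    ext v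
    simp [mem_farEnds]
  have h2 : ∑ z : {v // v ∈ farEnds G u}, x z =
      ∑ v ∈ Finset.univ.filter (· ∈ farEnds G u), x v :=
    (Finset.sum_subtype _ (by simp) _).symm
  rw [h2, ← h1, Finset.sum_image, Finset.mul_sum]
  · exact Finset.sum_le_sum fun d _ => mul_le_mul_of_nonneg_right (hmax _) (hx _)
  · rintro ⟨a, b⟩ h ⟨c, d⟩ h' he
    simp only [Finset.coe_filter, Finset.mem_univ, true_and, Set.mem_ofPred_eq] at h h' he
    subst he
    rw [(h.eq_of_reachable hG h' (Reachable.refl _)).1]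

lemma quad_le_bridgeless_add [Fintype {v // v ∈ farEnds G u}] (hG : G.Connected) {x : V → ℝ}
    (hx : ∀ a, 0 ≤ x a) (hmax : ∀ a, x a ≤ x u) :
    ∑ a, x a * ∑ b ∈ nb G a, x b ≤ ∑ a, x a * ∑ b ∈ nb (bridgeless G) a, x b +
      2 * x u * ∑ z : {v // v ∈ farEnds G u}, x z := by
  classical
  have h1 := sum_farDarts_le hG hx hmax
  have h2 : ∑ d : V × V with FarDart G u d.2 d.1, x d.1 * x d.2 =
      ∑ d : V × V with FarDart G u d.1 d.2, x d.1 * x d.2 := by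
    rw [Finset.sum_filter, Finset.sum_filter, ← (Equiv.prodComm V V).sum_comp]
    refine Finset.sum_congr rfl fun d _ => ?_
    simp [mul_comm]
  have h3 : ∑ d : V × V with G.Adj d.1 d.2, x d.1 * x d.2 ≤
      ∑ d : V × V with (bridgeless G).Adj d.1 d.2, x d.1 * x d.2 +
      (∑ d : V × V with FarDart G u d.1 d.2, x d.1 * x d.2 +
      ∑ d : V × V with FarDart G u d.2 d.1, x d.1 * x d.2) := by
    simp only [Finset.sum_filter]
    rw [← Finset.sum_add_distrib, ← Finset.sum_add_distrib]
    refine Finset.sum_le_sum fun d _ => ?_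
    have h0 : 0 ≤ x d.1 * x d.2 := mul_nonneg (hx _) (hx _)
    by_cases hd : G.Adj d.1 d.2
    · by_cases hb : s(d.1, d.2) ∈ bridgeSet G
      · rcases farDart_or_of_mem_bridgeSet (u := u) hG hb with h' | h'
        · rw [if_pos hd, if_pos h']
          split_ifs <;> linarith
        · rw [if_pos hd, if_pos h']
          split_ifs <;> linarith
      · rw [if_pos hd, if_pos (bridgeless_adj.2 ⟨hd, hb⟩)]
        split_ifs <;> linarith
    · rw [if_neg hd]
      split_ifs <;> linarith
  rw [quad_eq_sum_darts, quad_eq_sum_darts]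
  linarith

lemma quad_le_collapsePend [Fintype {v // v ∈ farEnds G u}] [Fintype {v // v ∉ farEnds G u}]
    (hG : G.Connected) {x : V → ℝ} (hx : ∀ a, 0 ≤ x a) (hmax : ∀ a, x a ≤ x u) :
    ∑ a, x a * ∑ b ∈ nb G a, x b ≤ ∑ t, x (farEquiv G u t) *
      ∑ t' ∈ nb (collapsePend G u) t, x (farEquiv G u t') := by
  rw [quad_pend (fun t => x (farEquiv G u t))]
  have h1 := quad_le_bridgeless_add hG hx hmax
  have h2 := quad_bridgeless_le hG hx hmax
  simp only [farEquiv_inl, farEquiv_inr, rootVertex]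
  linarith

/-- If the neighbour sums at the root agree for a positive vector, then the neighbours of the
root agree. -/
lemma adj_root_of_sum_eq [Fintype {v // v ∈ farEnds G u}] [Fintype {v // v ∉ farEnds G u}]
    (hG : G.Connected) {x : V → ℝ} (hx : ∀ a, 0 < x a)
    (he : ∑ t ∈ nb (collapsePend G u) (Sum.inl (rootVertex G u)), x (farEquiv G u t) =
      ∑ b ∈ nb G u, x b) (t : {v // v ∉ farEnds G u} ⊕ {v // v ∈ farEnds G u})
    (ht : (collapsePend G u).Adj (Sum.inl (rootVertex G u)) t) : G.Adj u (farEquiv G u t) := by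
  classical
  by_contra hcon
  have h1 : ∑ b ∈ nb G u, x b =
      ∑ t with G.Adj u (farEquiv G u t), x (farEquiv G u t) := by
    rw [nb, Finset.sum_filter, Finset.sum_filter, ← (farEquiv G u).sum_comp]
  have h2 : ∑ t with G.Adj u (farEquiv G u t), x (farEquiv G u t) <
      ∑ t ∈ nb (collapsePend G u) (Sum.inl (rootVertex G u)), x (farEquiv G u t) := by
    refine Finset.sum_lt_sum_of_subset (i := t) (fun t' ht' => ?_) (mem_nb.2 ht)
      (by simpa using hcon) (hx _) fun _ _ _ => (hx _).le
    exact mem_nb.2 (collapsePend_adj_of_adj_root hG (Finset.mem_filter.1 ht').2)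
  rw [he, h1] at h2
  exact lt_irrefl _ h2

end Comparison

section Main

variable {V : Type*} [Fintype V] [DecidableEq V]

lemma specRad_eq_of_iso {W : Type*} [Fintype W] [Nonempty W] {G : SimpleGraph V}
    {K : SimpleGraph W} (e : G ≃g K) {y : W → ℝ} {r : ℝ} (hy : ∀ a, 0 < y a)
    (hr : ∀ a, ∑ b ∈ nb K a, y b = r * y a) : specRad G = r := by
  classical
  have : Nonempty V := e.toEquiv.nonempty
  refine specRad_eq_of_pos_eigenvector (y := fun a => y (e a)) (fun a => hy _) fun a => ?_
  rw [← hr, nb, nb, Finset.sum_filter, Finset.sum_filter, ← e.toEquiv.sum_comp]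
  refine Finset.sum_congr rfl fun b _ => ?_
  simp [e.map_adj_iff]

lemma specRad_eq_of_iso_Kbook {G : SimpleGraph V} {p m : ℕ} (e : G ≃g Kbook p m) {μ : ℝ}
    (hμ : (μ - m) * (μ - m - p) = m ^ 2) (hm : 0 < m) (hmμ : m < μ) :
    specRad G = Real.sqrt μ := by
  classical
  have hm0 : (0 : ℝ) < m := by exact_mod_cast hm
  have hμ0 : 0 < μ := hm0.trans hmμ
  have hd : 0 < μ - m := sub_pos.2 hmμ
  have hl : 0 < Real.sqrt μ := Real.sqrt_pos.2 hμ0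
  have hsq : Real.sqrt μ * Real.sqrt μ = μ := Real.mul_self_sqrt hμ0.le
  set l := Real.sqrt μ with hl_def
  have hη : 1 + (m : ℝ) / (μ - m) = μ / (μ - m) := by
    field_simp
    ring
  refine specRad_eq_of_iso e (y := fun t => match t with
    | Sum.inl (Sum.inl _) => 1
    | Sum.inl (Sum.inr _) => m / (μ - m)
    | Sum.inr (Sum.inl _) => (1 + m / (μ - m)) / l
    | Sum.inr (Sum.inr _) => 1 / l) ?_ ?_
  · rintro ((_ | _) | (_ | _)) <;> dsimp only <;> positivity
  · rintro ((_ | _) | (_ | _)) <;>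
      simp only [nb, Finset.sum_filter, Fintype.sum_sum_type, Kbook, fromRel_adj] <;> simp
    · rw [hη]
      field_simp
      rw [sq, hsq]
      linear_combination -hμ
    · rw [hη]
      field_simp
      rw [sq, hsq]
    · field_simp
    · field_simp

lemma nonempty_iso_Kbook_of_sqrt_le {G : SimpleGraph V} {k m p : ℕ}
    (hG : IsMinimallyKLEdgeConnected k k G) (hk : k = p + 2) (hV : Fintype.card V = m + p + 2)
    (hm : 3 * p + 6 ≤ m) {μ : ℝ} (hμ : (μ - m) * (μ - m - p) = m ^ 2)
    (hμ2 : 2 * m + (p : ℝ) / 2 ≤ μ) (hle : Real.sqrt μ ≤ specRad G) :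
    specRad G = Real.sqrt μ ∧ Nonempty (G ≃g Kbook p m) := by
  classical
  have hkV : k ≤ Nat.card V := by rw [Nat.card_eq_fintype_card]; omega
  have hμ0 : 0 < μ := by
    have : (6 : ℝ) ≤ m := by exact_mod_cast (by omega : 6 ≤ m)
    have : (0 : ℝ) ≤ p := Nat.cast_nonneg _
    linarith
  have hr : 0 < specRad G := (Real.sqrt_pos.2 hμ0).trans_le hle
  have hr2 : μ ≤ specRad G ^ 2 := (Real.sqrt_le_left hr.le).1 hle
  have := hG.1.nonempty
  obtain ⟨x, hx0, hxne, he⟩ := exists_nonneg_eigenvector G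
  have hx := eigenvector_pos hG.1 hx0 hxne he
  obtain ⟨u, hmax⟩ := Finite.exists_max x
  have hb := hG.ncard_bridgeSet_add_two_le hkV (by omega)
  rcases hb.eq_or_lt with hb | hb
  · have hcF : Fintype.card {v // v ∈ farEnds G u} = p := by
      have h1 := ncard_farEnds hG.1 u
      rw [← Nat.card_coe_set_eq, Nat.card_eq_fintype_card] at h1
      rw [show Fintype.card {v // v ∈ farEnds G u} = (bridgeSet G).ncard from h1]
      omega
    have hcU : Fintype.card {v // v ∉ farEnds G u} = m + 2 := by
      have := Fintype.card_congr (farEquiv G u)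
      rw [Fintype.card_sum] at this
      omega
    have hcut := hG.cutProp_collapse hkV hb.le u
    have h1 : specRad (collapsePend G u) ≤ Real.sqrt μ :=
      specRad_pend_le hcut hcU (by omega) (by rw [hcF]; exact hμ) (by rw [hcF]; exact hμ2) _
    set y : {v // v ∉ farEnds G u} ⊕ {v // v ∈ farEnds G u} → ℝ :=
      fun t => x (farEquiv G u t) with hy
    have hsum : ∑ t, y t ^ 2 = ∑ a, x a ^ 2 := (farEquiv G u).sum_comp fun a => x a ^ 2
    have hpos : 0 < ∑ t, y t ^ 2 := by
      rw [hsum]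
      exact Finset.sum_pos (fun a _ => pow_pos (hx a) 2) ⟨u, Finset.mem_univ u⟩
    have h2 : specRad G * ∑ t, y t ^ 2 ≤
        ∑ t, y t * ∑ t' ∈ nb (collapsePend G u) t, y t' := by
      refine le_trans (le_of_eq ?_) (quad_le_collapsePend hG.1 hx0 hmax)
      rw [hsum, Finset.mul_sum]
      exact Finset.sum_congr rfl fun a _ => by rw [he]; ring
    have h3 := quad_le_specRad (collapsePend G u) y
    have h4 := le_of_mul_le_mul_right (h2.trans h3) hpos
    have hrG : specRad G = Real.sqrt μ := le_antisymm (h4.trans h1) hle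
    have hrP : specRad (collapsePend G u) = specRad G :=
      le_antisymm (h1.trans hle) h4
    have h5 := eigen_of_quad_eq (collapsePend G u) y (by rw [hrP]; exact h2)
    rw [hrP] at h5
    refine ⟨hrG, ?_⟩
    have E := pendantEigen_of_pend (x := y) hr (fun t => hx0 _) (hx _) (fun a => hmax _) h5
    rw [hcF] at E
    obtain ⟨-, w, hwu, huw, hw1, hw2⟩ := E.structure_thm hcut hcU hm hμ hμ2 hr2
    obtain ⟨e1⟩ := nonempty_pend_iso_Kbook hcU (Fintype.equivFinOfCardEq hcF) hwu huw hw1 hw2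
    obtain ⟨e2⟩ := nonempty_collapsePend_iso hG.1
      (adj_root_of_sum_eq hG.1 hx ((h5 _).trans (he u).symm))
    exact ⟨(e1.trans e2).symm⟩
  · exfalso
    have hcut := hG.cutProp2 hkV (by omega)
    have E : PendantEigen G u 0 (specRad G) (fun a => x a / x u) :=
      { nonneg := fun a => div_nonneg (hx0 a) (hx0 u)
        le_one := fun a => (div_le_one (hx u)).2 (hmax a)
        at_root := div_self (hx u).ne'
        pos := hr
        eigen := fun s _ => by rw [← Finset.sum_div, he, mul_div_assoc]
        eigen_root := by
          rw [← Finset.sum_div, he, mul_div_assoc, div_self (hx u).ne']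
          simp }
    exact E.false_of_cutProp2 hcut hV hm (hμ2.trans hr2)

end Main

/-- Let `k ≥ 2` and let `G` be a minimally `(k,k)`-edge-connected graph of order `n ≥ 4k`.
Then `ρ(G) ≤ √(4n − 2k − 4 + 2√(5k² − 8kn + 4n² − 4k + 4)) / 2`, with equality
if and only if `G ≅ K^{k−2}_{2,n−k}`. -/
theorem spectral_radius_of_minimally_kk_edge_connected_order
    {V : Type*} [Fintype V] [DecidableEq V] (G : SimpleGraph V) (k n : ℕ)
    (hk : 2 ≤ k) (hcard : Fintype.card V = n) (hn : 4 * k ≤ n)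
    (hG : IsMinimallyKLEdgeConnected k k G) :
    specRad G ≤
      Real.sqrt (4 * (n : ℝ) - 2 * (k : ℝ) - 4 +
        2 * Real.sqrt (5 * (k : ℝ) ^ 2 - 8 * (k : ℝ) * (n : ℝ) + 4 * (n : ℝ) ^ 2
          - 4 * (k : ℝ) + 4)) / 2 ∧
    (specRad G =
      Real.sqrt (4 * (n : ℝ) - 2 * (k : ℝ) - 4 +
        2 * Real.sqrt (5 * (k : ℝ) ^ 2 - 8 * (k : ℝ) * (n : ℝ) + 4 * (n : ℝ) ^ 2
          - 4 * (k : ℝ) + 4)) / 2 ↔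
      Nonempty (G ≃g Kbook (k - 2) (n - k))) := by
  obtain ⟨p, rfl⟩ : ∃ p, k = p + 2 := ⟨k - 2, by omega⟩
  obtain ⟨m, rfl⟩ : ∃ m, n = m + p + 2 := ⟨n - p - 2, by omega⟩
  have hm : 3 * p + 6 ≤ m := by omega
  have hp0 : (0 : ℝ) ≤ p := Nat.cast_nonneg _
  have hm0 : (0 : ℝ) < m := by exact_mod_cast (by omega : 0 < m)
  rw [show p + 2 - 2 = p by omega, show m + p + 2 - (p + 2) = m by omega,
    show (5 * ((p + 2 : ℕ) : ℝ) ^ 2 - 8 * ((p + 2 : ℕ) : ℝ) * ((m + p + 2 : ℕ) : ℝ) +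
      4 * ((m + p + 2 : ℕ) : ℝ) ^ 2 - 4 * ((p + 2 : ℕ) : ℝ) + 4) = 4 * m ^ 2 + p ^ 2 by
      push_cast; ring]
  set q := Real.sqrt (4 * (m : ℝ) ^ 2 + p ^ 2) with hq
  have hqq : q ^ 2 = 4 * (m : ℝ) ^ 2 + p ^ 2 := Real.sq_sqrt (by positivity)
  have hq2 : 2 * (m : ℝ) ≤ q := Real.le_sqrt_of_sq_le (by nlinarith [sq_nonneg (p : ℝ)])
  set μ := (2 * m + p + q) / 2 with hμ_def
  rw [show 4 * ((m + p + 2 : ℕ) : ℝ) - 2 * ((p + 2 : ℕ) : ℝ) - 4 + 2 * q = 2 ^ 2 * μ by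
    rw [hμ_def]; push_cast; ring, Real.sqrt_mul (by norm_num), Real.sqrt_sq (by norm_num),
    mul_div_cancel_left₀ _ (by norm_num)]
  have hμ : (μ - m) * (μ - m - p) = m ^ 2 := by
    rw [hμ_def]
    linear_combination hqq / 4
  have hμ2 : 2 * m + (p : ℝ) / 2 ≤ μ := by
    rw [hμ_def]
    linarith
  have key := nonempty_iso_Kbook_of_sqrt_le hG rfl hcard hm hμ hμ2
  refine ⟨?_, fun h => (key h.ge).2, fun ⟨e⟩ =>
    specRad_eq_of_iso_Kbook e hμ (by omega) (by linarith)⟩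
  rcases le_total (specRad G) (Real.sqrt μ) with h | h
  · exact h
  · exact (key h).1.le
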